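/- arXiv:1002.1008 — 2 statements merged into one kernel-verified Lean document; each statement's English description precedes it below -/
import Mathlib

section
/- For a binary form f ∈ V_10, the eleven invariants j_2, j_4, j_6, A_6, B_6, j_8, j_9, j_10, A_12, j_14 and A_14 all vanish at f if and only if f has a root of multiplicity at least 6; i.e., the common vanishing locus of these eleven invariants is exactly the nullcone of V_10. -/
open MvPolynomial

/-- The `k`-th transvectant of two binary forms `f` of degree `n` and `g` of degree `m`. -/
noncomputable def transv (n m k : ℕ)
    (f g : MvPolynomial (Fin 2) ℂ) : MvPolynomial (Fin 2) ℂ :=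
  ((((n - k).factorial * (m - k).factorial : ℕ) : ℂ) / ((n.factorial * m.factorial : ℕ) : ℂ)) •
    ∑ i ∈ Finset.range (k + 1),
      ((-1 : ℂ) ^ i * (k.choose i : ℂ)) •
        ((fun p => pderiv (0 : Fin 2) p)^[k - i] ((fun p => pderiv (1 : Fin 2) p)^[i] f) *
         (fun p => pderiv (0 : Fin 2) p)^[i] ((fun p => pderiv (1 : Fin 2) p)^[k - i] g))

/-- A binary form `f` has a root of multiplicity (at least) `r` if some nonzero linear
form `ℓ = αx + βy` satisfies `ℓ^r ∣ f`. -/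
def HasRootOfMult (r : ℕ) (f : MvPolynomial (Fin 2) ℂ) : Prop :=
  ∃ a b : ℂ, (a ≠ 0 ∨ b ≠ 0) ∧ (C a * X 0 + C b * X 1) ^ r ∣ f

/-- The covariant `k = (f,f)₈ ∈ V₄` of a binary decimic `f`. -/
noncomputable def covK (f : MvPolynomial (Fin 2) ℂ) : MvPolynomial (Fin 2) ℂ :=
  transv 10 10 8 f f

/-- The covariant `m = (f,k)₄ ∈ V₆` of a binary decimic `f`. -/
noncomputable def covM (f : MvPolynomial (Fin 2) ℂ) : MvPolynomial (Fin 2) ℂ :=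
  transv 10 4 4 f (covK f)

/-- The covariant `q = (f,f)₆ ∈ V₈` of a binary decimic `f`. -/
noncomputable def covQ (f : MvPolynomial (Fin 2) ℂ) : MvPolynomial (Fin 2) ℂ :=
  transv 10 10 6 f f

/-- The covariant `r = (f,q)₈ ∈ V₂` of a binary decimic `f`. -/
noncomputable def covR (f : MvPolynomial (Fin 2) ℂ) : MvPolynomial (Fin 2) ℂ :=
  transv 10 8 8 f (covQ f)

/-- The covariant `k_q = (q,q)₆ ∈ V₄` of a binary decimic `f`. -/
noncomputable def covKq (f : MvPolynomial (Fin 2) ℂ) : MvPolynomial (Fin 2) ℂ :=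
  transv 8 8 6 (covQ f) (covQ f)

/-- The covariant `k_m = (m,m)₄ ∈ V₄` of a binary decimic `f`. -/
noncomputable def covKm (f : MvPolynomial (Fin 2) ℂ) : MvPolynomial (Fin 2) ℂ :=
  transv 6 6 4 (covM f) (covM f)

/-- The covariant `m_q = (q,k_q)₄ ∈ V₄` of a binary decimic `f`. -/
noncomputable def covMq (f : MvPolynomial (Fin 2) ℂ) : MvPolynomial (Fin 2) ℂ :=
  transv 8 4 4 (covQ f) (covKq f)

/-- The invariant `j₂ = (f,f)₁₀` of a binary decimic `f` (a form of order 0, i.e. a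
constant polynomial). -/
noncomputable def j2 (f : MvPolynomial (Fin 2) ℂ) : MvPolynomial (Fin 2) ℂ :=
  transv 10 10 10 f f

/-- The invariant `j₄ = (k,k)₄` of a binary decimic `f`. -/
noncomputable def j4 (f : MvPolynomial (Fin 2) ℂ) : MvPolynomial (Fin 2) ℂ :=
  transv 4 4 4 (covK f) (covK f)

/-- The invariant `j₆ = ((k,k)₂,k)₄` of a binary decimic `f`. -/
noncomputable def j6 (f : MvPolynomial (Fin 2) ℂ) : MvPolynomial (Fin 2) ℂ :=
  transv 4 4 4 (transv 4 4 2 (covK f) (covK f)) (covK f)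

/-- The invariant `A₆ = (m,m)₆` of a binary decimic `f`. -/
noncomputable def A6 (f : MvPolynomial (Fin 2) ℂ) : MvPolynomial (Fin 2) ℂ :=
  transv 6 6 6 (covM f) (covM f)

/-- The invariant `B₆ = ((q,q)₄,q)₈` of a binary decimic `f`. -/
noncomputable def B6 (f : MvPolynomial (Fin 2) ℂ) : MvPolynomial (Fin 2) ℂ :=
  transv 8 8 8 (transv 8 8 4 (covQ f) (covQ f)) (covQ f)

/-- The invariant `C₆ = (r,r)₂` of a binary decimic `f`. -/
noncomputable def C6 (f : MvPolynomial (Fin 2) ℂ) : MvPolynomial (Fin 2) ℂ :=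
  transv 2 2 2 (covR f) (covR f)

/-- The invariant `j₈ = (k,k_m)₄` of a binary decimic `f`. -/
noncomputable def j8 (f : MvPolynomial (Fin 2) ℂ) : MvPolynomial (Fin 2) ℂ :=
  transv 4 4 4 (covK f) (covKm f)

/-- The invariant `j₉ = ((m,k)₁,k²)₈` of a binary decimic `f`. -/
noncomputable def j9 (f : MvPolynomial (Fin 2) ℂ) : MvPolynomial (Fin 2) ℂ :=
  transv 8 8 8 (transv 6 4 1 (covM f) (covK f)) (covK f ^ 2)

/-- The invariant `j₁₀ = ((m,m)₂,k²)₈` of a binary decimic `f`. -/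
noncomputable def j10 (f : MvPolynomial (Fin 2) ℂ) : MvPolynomial (Fin 2) ℂ :=
  transv 8 8 8 (transv 6 6 2 (covM f) (covM f)) (covK f ^ 2)

/-- The invariant `A₁₂ = (m²,k³)₁₂` of a binary decimic `f`. -/
noncomputable def A12 (f : MvPolynomial (Fin 2) ℂ) : MvPolynomial (Fin 2) ℂ :=
  transv 12 12 12 (covM f ^ 2) (covK f ^ 3)

/-- The invariant `j₁₄ = ((k_q,k_q)₂,m_q)₄` of a binary decimic `f`. -/
noncomputable def j14 (f : MvPolynomial (Fin 2) ℂ) : MvPolynomial (Fin 2) ℂ :=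
  transv 4 4 4 (transv 4 4 2 (covKq f) (covKq f)) (covMq f)

/-- The invariant `A₁₄ = (((k,k)₂)²,(m,m)₂)₈` of a binary decimic `f`. -/
noncomputable def A14 (f : MvPolynomial (Fin 2) ℂ) : MvPolynomial (Fin 2) ℂ :=
  transv 8 8 8 (transv 4 4 2 (covK f) (covK f) ^ 2) (transv 6 6 2 (covM f) (covM f))

/-- The binary form `Σ binom(n,i) a_i x^{n-i} y^i` of degree `n`. -/
noncomputable def binForm (n : ℕ) (a : ℕ → ℂ) : MvPolynomial (Fin 2) ℂ :=
  ∑ i ∈ Finset.range (n + 1), C (n.choose i * a i) * (X 0 ^ (n - i) * X 1 ^ i)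

theorem coeff_binForm (n : ℕ) (a : ℕ → ℂ) (m : Fin 2 →₀ ℕ) :
    coeff m (binForm n a) = if m 0 + m 1 = n then n.choose (m 1) * a (m 1) else 0 := by
  have key : ∀ i, coeff m (C (n.choose i * a i) * (X 0 ^ (n - i) * X 1 ^ i)) =
      if m 0 = n - i ∧ m 1 = i then (n.choose i * a i : ℂ) else 0 := by
    intro i
    rw [X_pow_eq_monomial, X_pow_eq_monomial, monomial_mul, C_mul_monomial, coeff_monomial,
      one_mul, mul_one]
    congr 1
    simp only [Finsupp.ext_iff, Fin.forall_fin_two, eq_iff_iff]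
    simp [eq_comm]
  rw [binForm, coeff_sum, Finset.sum_congr rfl fun i _ => key i]
  split_ifs with h
  · rw [Finset.sum_eq_single (m 1)]
    · rw [if_pos]; omega
    · intro i _ hi
      rw [if_neg]; omega
    · intro hi
      rw [Finset.mem_range] at hi
      omega
  · refine Finset.sum_eq_zero fun i hi => if_neg ?_
    rw [Finset.mem_range] at hi
    omega

theorem exists_eq_binForm {n : ℕ} {f : MvPolynomial (Fin 2) ℂ} (hf : f.IsHomogeneous n) :
    ∃ a, f = binForm n a := by
  refine ⟨fun i => coeff (Finsupp.single 0 (n - i) + Finsupp.single 1 i) f / n.choose i, ?_⟩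
  ext m
  rw [coeff_binForm]
  split_ifs with h
  · have hm : Finsupp.single 0 (n - m 1) + Finsupp.single 1 (m 1) = m := by
      ext i
      fin_cases i
      · simp; omega
      · simp
    have hc : (n.choose (m 1) : ℂ) ≠ 0 := by
      exact_mod_cast (Nat.choose_pos (by omega)).ne'
    rw [hm]
    field_simp
  · by_contra hne
    apply h
    have := hf hne
    rw [Finsupp.weight_apply, Finsupp.sum_fintype _ _ (by simp)] at this
    simpa [Fin.sum_univ_two] using this

theorem binForm_congr {n : ℕ} {a b : ℕ → ℂ} (h : ∀ i ≤ n, a i = b i) :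
    binForm n a = binForm n b :=
  Finset.sum_congr rfl fun i hi => by rw [h i (by rw [Finset.mem_range] at hi; omega)]

theorem binForm_inj {n : ℕ} {a b : ℕ → ℂ} (h : binForm n a = binForm n b) {i : ℕ}
    (hi : i ≤ n) : a i = b i := by
  have := congrArg (coeff (Finsupp.single 0 (n - i) + Finsupp.single 1 i)) h
  have hc : (n.choose i : ℂ) ≠ 0 := by
    exact_mod_cast (Nat.choose_pos hi).ne'
  simpa [coeff_binForm, hi, (Nat.choose_pos hi).ne'] using this

theorem smul_binForm (n : ℕ) (c : ℂ) (a : ℕ → ℂ) :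
    c • binForm n a = binForm n (fun i => c * a i) := by
  ext m
  rw [coeff_smul, coeff_binForm, coeff_binForm]
  split_ifs <;> simp [mul_left_comm]

theorem sum_binForm {ι : Type*} (s : Finset ι) (n : ℕ) (a : ι → ℕ → ℂ) :
    ∑ x ∈ s, binForm n (a x) = binForm n (fun i => ∑ x ∈ s, a x i) := by
  ext m
  simp only [coeff_sum, coeff_binForm]
  split_ifs <;> simp [Finset.mul_sum]

theorem binForm_zero_degree (a : ℕ → ℂ) : binForm 0 a = C (a 0) := by
  simp [binForm]

theorem pderiv_zero_binForm (n : ℕ) (a : ℕ → ℂ) :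
    pderiv 0 (binForm (n + 1) a) = ((n + 1 : ℕ) : ℂ) • binForm n a := by
  ext m
  rw [coeff_pderiv, coeff_smul, coeff_binForm, coeff_binForm]
  simp only [Finsupp.add_apply, Finsupp.single_eq_same, Finsupp.single_apply]
  by_cases h : m 0 + m 1 = n
  · have h1 : m 0 + 1 + m 1 = n + 1 := by omega
    have h2 : n.choose (m 1) * (n + 1) = (n + 1).choose (m 1) * (m 0 + 1) := by
      rw [Nat.choose_mul_succ_eq, show n + 1 - m 1 = m 0 + 1 by omega]
    have h3 : n.choose (m 1) * ((n : ℂ) + 1) = (n + 1).choose (m 1) * (m 0 + 1) := by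
      exact_mod_cast h2
    simp [h, h1]
    linear_combination (-a (m 1)) * h3
  · have h1 : ¬ (m 0 + 1 + m 1 = n + 1) := by omega
    simp [h, h1]

theorem pderiv_one_binForm (n : ℕ) (a : ℕ → ℂ) :
    pderiv 1 (binForm (n + 1) a) = ((n + 1 : ℕ) : ℂ) • binForm n (fun i => a (i + 1)) := by
  ext m
  rw [coeff_pderiv, coeff_smul, coeff_binForm, coeff_binForm]
  simp only [Finsupp.add_apply, Finsupp.single_eq_same, Finsupp.single_apply]
  by_cases h : m 0 + m 1 = n
  · have h1 : m 0 + (m 1 + 1) = n + 1 := by omega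
    have h3 : ((n : ℂ) + 1) * n.choose (m 1) = (n + 1).choose (m 1 + 1) * (m 1 + 1) := by
      exact_mod_cast Nat.add_one_mul_choose_eq n (m 1)
    simp [h, h1]
    linear_combination (-a (m 1 + 1)) * h3
  · have h1 : ¬ (m 0 + (m 1 + 1) = n + 1) := by omega
    simp [h, h1]

theorem iterate_smul_pderiv (j : Fin 2) (p : ℕ) (c : ℂ) (g : MvPolynomial (Fin 2) ℂ) :
    (fun g => pderiv j g)^[p] (c • g) = c • (fun g => pderiv j g)^[p] g :=
  (Function.Semiconj.iterate_right (f := fun g => c • g) (fun g => by simp) p g).symm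

theorem iterate_pderiv_zero_binForm (n p : ℕ) (a : ℕ → ℂ) :
    (fun g => pderiv 0 g)^[p] (binForm (n + p) a) =
      (((n + p).descFactorial p : ℕ) : ℂ) • binForm n a := by
  induction p with
  | zero => simp
  | succ p ih =>
    rw [Function.iterate_succ_apply, ← add_assoc, pderiv_zero_binForm]
    rw [iterate_smul_pderiv, ih, smul_smul, Nat.succ_descFactorial_succ]
    push_cast
    ring_nf

theorem iterate_pderiv_one_binForm (n p : ℕ) (a : ℕ → ℂ) :
    (fun g => pderiv 1 g)^[p] (binForm (n + p) a) =
      (((n + p).descFactorial p : ℕ) : ℂ) • binForm n (fun i => a (i + p)) := by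
  induction p generalizing a with
  | zero => simp
  | succ p ih =>
    rw [Function.iterate_succ_apply, ← add_assoc, pderiv_one_binForm]
    rw [iterate_smul_pderiv, ih, smul_smul, Nat.succ_descFactorial_succ]
    push_cast
    ring_nf

theorem mixed_pderiv_binForm (n p q : ℕ) (a : ℕ → ℂ) :
    (fun g => pderiv 0 g)^[p] ((fun g => pderiv 1 g)^[q] (binForm (n + p + q) a)) =
      ((((n + p + q).factorial : ℕ) : ℂ) / ((n.factorial : ℕ) : ℂ)) •
        binForm n (fun i => a (i + q)) := by
  rw [iterate_pderiv_one_binForm, iterate_smul_pderiv, iterate_pderiv_zero_binForm, smul_smul]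
  congr 1
  have h1 := Nat.factorial_mul_descFactorial (show q ≤ n + p + q by omega)
  have h2 := Nat.factorial_mul_descFactorial (show p ≤ n + p by omega)
  rw [show n + p + q - q = n + p by omega] at h1
  rw [show n + p - p = n by omega] at h2
  have hn : ((n.factorial : ℕ) : ℂ) ≠ 0 := by exact_mod_cast n.factorial_ne_zero
  rw [eq_div_iff hn]
  have : (n + p + q).descFactorial q * (n + p).descFactorial p * n.factorial =
      (n + p + q).factorial := by
    rw [← h1, ← h2]; ring
  exact_mod_cast this

/-- Coefficients of the product of two binary forms, in the normalization of `binForm`. -/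
noncomputable def mulCoeff (p q : ℕ) (a b : ℕ → ℂ) (l : ℕ) : ℂ :=
  (∑ i ∈ Finset.range (l + 1), (p.choose i * q.choose (l - i) : ℂ) * (a i * b (l - i))) /
    (p + q).choose l

theorem binForm_mul (p q : ℕ) (a b : ℕ → ℂ) :
    binForm p a * binForm q b = binForm (p + q) (mulCoeff p q a b) := by
  unfold binForm
  rw [Finset.sum_mul_sum, ← Finset.sum_product',
    ← Finset.sum_fiberwise_of_maps_to (t := Finset.range (p + q + 1)) (g := fun x => x.1 + x.2)
      (by
        intro x hx
        simp only [Finset.mem_product, Finset.mem_range] at hx ⊢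
        omega)]
  refine Finset.sum_congr rfl fun l hl => ?_
  rw [Finset.mem_range] at hl
  have hc : ((p + q).choose l : ℂ) ≠ 0 := by
    exact_mod_cast (Nat.choose_pos (by omega)).ne'
  rw [mulCoeff, mul_div_cancel₀ _ hc, map_sum, Finset.sum_mul,
    ← Finset.Nat.sum_antidiagonal_eq_sum_range_succ
      (fun i j => C ((p.choose i * q.choose j : ℂ) * (a i * b j)) *
        (X 0 ^ (p + q - l) * X 1 ^ l : MvPolynomial (Fin 2) ℂ))]
  refine Eq.trans (Finset.sum_congr rfl ?_) (Finset.sum_subset ?_ ?_)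
  · intro x hx
    simp only [Finset.mem_filter, Finset.mem_product, Finset.mem_range] at hx
    obtain ⟨⟨h1, h2⟩, rfl⟩ := hx
    rw [show p + q - (x.1 + x.2) = (p - x.1) + (q - x.2) by omega]
    simp only [C_mul, pow_add]
    ring
  · intro x hx
    simp only [Finset.mem_filter] at hx
    simpa using hx.2
  · intro x hx hx'
    simp only [Finset.mem_filter, Finset.mem_product, Finset.mem_range] at hx'
    replace hx := Finset.HasAntidiagonal.mem_antidiagonal.mp hx
    rcases Nat.lt_or_ge p x.1 with h | h
    · simp [Nat.choose_eq_zero_of_lt h]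
    · have : q < x.2 := by
        by_contra h'
        exact hx' ⟨⟨by omega, by omega⟩, hx⟩
      simp [Nat.choose_eq_zero_of_lt this]

/-- Coefficients of the `k`-th transvectant of two binary forms, in the normalization of
`binForm`. -/
noncomputable def transvCoeff (n m k : ℕ) (a b : ℕ → ℂ) (l : ℕ) : ℂ :=
  ∑ i ∈ Finset.range (k + 1), ((-1 : ℂ) ^ i * k.choose i) *
    mulCoeff (n - k) (m - k) (fun j => a (j + i)) (fun j => b (j + (k - i))) l

theorem transv_binForm {n m k : ℕ} (hn : k ≤ n) (hm : k ≤ m) (a b : ℕ → ℂ) :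
    transv n m k (binForm n a) (binForm m b) =
      binForm (n - k + (m - k)) (transvCoeff n m k a b) := by
  unfold transv transvCoeff
  rw [← sum_binForm, Finset.smul_sum]
  refine Finset.sum_congr rfl fun i hi => ?_
  rw [Finset.mem_range] at hi
  have e1 := mixed_pderiv_binForm (n - k) (k - i) i a
  have e2 := mixed_pderiv_binForm (m - k) i (k - i) b
  rw [show n - k + (k - i) + i = n by omega] at e1
  rw [show m - k + i + (k - i) = m by omega] at e2
  rw [e1, e2, smul_mul_smul_comm, binForm_mul, ← smul_binForm, smul_smul, smul_smul]
  congr 1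
  have h1 : ((n.factorial : ℕ) : ℂ) ≠ 0 := by exact_mod_cast n.factorial_ne_zero
  have h2 : ((m.factorial : ℕ) : ℂ) ≠ 0 := by exact_mod_cast m.factorial_ne_zero
  have h3 : (((n - k).factorial : ℕ) : ℂ) ≠ 0 := by exact_mod_cast (n - k).factorial_ne_zero
  have h4 : (((m - k).factorial : ℕ) : ℂ) ≠ 0 := by exact_mod_cast (m - k).factorial_ne_zero
  push_cast
  field_simp

/-- The linear substitution `x ↦ a x + b y`, `y ↦ c x + d y`. -/
noncomputable def linSubst (a b c d : ℂ) : MvPolynomial (Fin 2) ℂ →ₐ[ℂ] MvPolynomial (Fin 2) ℂ :=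
  aeval ![C a * X 0 + C b * X 1, C c * X 0 + C d * X 1]

theorem linSubst_X_zero (a b c d : ℂ) :
    linSubst a b c d (X 0) = C a * X 0 + C b * X 1 := by
  simp [linSubst]

theorem linSubst_X_one (a b c d : ℂ) :
    linSubst a b c d (X 1) = C c * X 0 + C d * X 1 := by
  simp [linSubst]

theorem linSubst_C (a b c d r : ℂ) : linSubst a b c d (C r) = C r :=
  (linSubst a b c d).commutes r

theorem pderiv_zero_linSubst (a b c d : ℂ) (f : MvPolynomial (Fin 2) ℂ) :
    pderiv 0 (linSubst a b c d f) =
      a • linSubst a b c d (pderiv 0 f) + c • linSubst a b c d (pderiv 1 f) := by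
  induction f using MvPolynomial.induction_on with
  | C r => simp
  | add p q hp hq => simp only [map_add, hp, hq, smul_add]; abel
  | mul_X p i hp =>
    fin_cases i <;>
      simp [hp, pderiv_X, linSubst_X_zero, linSubst_X_one, smul_eq_C_mul] <;> ring

theorem pderiv_one_linSubst (a b c d : ℂ) (f : MvPolynomial (Fin 2) ℂ) :
    pderiv 1 (linSubst a b c d f) =
      b • linSubst a b c d (pderiv 0 f) + d • linSubst a b c d (pderiv 1 f) := by
  induction f using MvPolynomial.induction_on with
  | C r => simp
  | add p q hp hq => simp only [map_add, hp, hq, smul_add]; abel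
  | mul_X p i hp =>
    fin_cases i <;>
      simp [hp, pderiv_X, linSubst_X_zero, linSubst_X_one, smul_eq_C_mul] <;> ring

open TensorProduct in
/-- Cayley's omega process `∂₀ ⊗ ∂₁ - ∂₁ ⊗ ∂₀`. -/
noncomputable def cayleyOmega :
    Module.End ℂ (MvPolynomial (Fin 2) ℂ ⊗[ℂ] MvPolynomial (Fin 2) ℂ) :=
  TensorProduct.map (pderiv 0).toLinearMap (pderiv 1).toLinearMap -
    TensorProduct.map (pderiv 1).toLinearMap (pderiv 0).toLinearMap

open TensorProduct in
theorem map_sub_map_pow_tmul {M : Type*} [AddCommGroup M] [Module ℂ M] {D E : Module.End ℂ M}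
    (h : Commute D E) (k : ℕ) (f g : M) :
    ((TensorProduct.map D E - TensorProduct.map E D : Module.End ℂ (M ⊗[ℂ] M)) ^ k) (f ⊗ₜ g) =
      ∑ i ∈ Finset.range (k + 1), ((-1 : ℂ) ^ i * (k.choose i : ℂ)) •
        (((D ^ (k - i)) ((E ^ i) f)) ⊗ₜ[ℂ] ((D ^ i) ((E ^ (k - i)) g))) := by
  have hED : Commute (TensorProduct.map E D : Module.End ℂ (M ⊗[ℂ] M))
      (TensorProduct.map D E : Module.End ℂ (M ⊗[ℂ] M)) := by
    rw [commute_iff_eq, ← TensorProduct.map_mul, ← TensorProduct.map_mul, h.eq]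
  have hc := hED.neg_left
  rw [sub_eq_neg_add, hc.add_pow, LinearMap.sum_apply]
  refine Finset.sum_congr rfl fun i _ => ?_
  rw [(hc.pow_pow i (k - i)).eq, ← Nat.cast_comm, ← nsmul_eq_mul, LinearMap.smul_apply,
    Module.End.mul_apply, neg_pow (TensorProduct.map E D), Module.End.mul_apply, TensorProduct.map_pow,
    TensorProduct.map_pow, TensorProduct.map_tmul]
  have hn : ∀ (l : ℕ) (z : M ⊗[ℂ] M),
      ((-1 : Module.End ℂ (M ⊗[ℂ] M)) ^ l) z = ((-1 : ℂ) ^ l) • z := by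
    intro l
    induction l with
    | zero => simp
    | succ l ih =>
      intro z
      rw [pow_succ, Module.End.mul_apply, ih, pow_succ, mul_smul, neg_one_smul]
      rfl
  rw [hn, map_smul, TensorProduct.map_tmul, mul_comm, mul_smul, Nat.cast_smul_eq_nsmul,
    ← Module.End.mul_apply (E ^ (k - i)), ← (h.pow_pow i (k - i)).eq, Module.End.mul_apply]

open TensorProduct in
theorem transv_eq_cayleyOmega (n m k : ℕ) (f g : MvPolynomial (Fin 2) ℂ) :
    transv n m k f g =
      ((((n - k).factorial * (m - k).factorial : ℕ) : ℂ) /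
        ((n.factorial * m.factorial : ℕ) : ℂ)) •
        LinearMap.mul' ℂ (MvPolynomial (Fin 2) ℂ) ((cayleyOmega ^ k) (f ⊗ₜ[ℂ] g)) := by
  unfold transv
  congr 1
  have hcd : Commute ((pderiv 0).toLinearMap : Module.End ℂ (MvPolynomial (Fin 2) ℂ))
      (pderiv 1).toLinearMap := by
    ext f m
    simp [coeff_pderiv, add_right_comm, mul_right_comm]
  have hp : ∀ (j : Fin 2) (l : ℕ) (h : MvPolynomial (Fin 2) ℂ),
      (fun p => pderiv j p)^[l] h =
        (((pderiv j).toLinearMap : Module.End ℂ (MvPolynomial (Fin 2) ℂ)) ^ l) h := by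
    intro j l h
    rw [Module.End.pow_apply]
    rfl
  rw [cayleyOmega, map_sub_map_pow_tmul hcd, map_sum]
  refine Finset.sum_congr rfl fun i _ => ?_
  rw [map_smul, LinearMap.mul'_apply, hp, hp, hp, hp]

open TensorProduct in
theorem cayleyOmega_map_linSubst (a b c d : ℂ)
    (z : MvPolynomial (Fin 2) ℂ ⊗[ℂ] MvPolynomial (Fin 2) ℂ) :
    cayleyOmega (TensorProduct.map (linSubst a b c d).toLinearMap
      (linSubst a b c d).toLinearMap z) =
    (a * d - b * c) • TensorProduct.map (linSubst a b c d).toLinearMap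
      (linSubst a b c d).toLinearMap (cayleyOmega z) := by
  induction z with
  | zero => simp
  | add x y hx hy => simp only [map_add, hx, hy, smul_add]
  | tmul f g =>
    simp only [cayleyOmega, LinearMap.sub_apply, TensorProduct.map_tmul, AlgHom.toLinearMap_apply,
      Derivation.coeFn_coe, pderiv_zero_linSubst, pderiv_one_linSubst, map_sub,
      TensorProduct.add_tmul, TensorProduct.tmul_add, TensorProduct.smul_tmul,
      TensorProduct.tmul_smul]
    module

theorem transv_linSubst (n m k : ℕ) (a b c d : ℂ) (f g : MvPolynomial (Fin 2) ℂ) :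
    transv n m k (linSubst a b c d f) (linSubst a b c d g) =
      (a * d - b * c) ^ k • linSubst a b c d (transv n m k f g) := by
  have hk : ∀ z, (cayleyOmega ^ k) (TensorProduct.map (linSubst a b c d).toLinearMap
      (linSubst a b c d).toLinearMap z) =
    (a * d - b * c) ^ k • TensorProduct.map (linSubst a b c d).toLinearMap
      (linSubst a b c d).toLinearMap ((cayleyOmega ^ k) z) := by
    induction k with
    | zero => simp
    | succ k ih =>
      intro z
      rw [pow_succ, Module.End.mul_apply, cayleyOmega_map_linSubst, map_smul, ih, smul_smul,
        Module.End.mul_apply, ← pow_succ']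
  have hm : ∀ z, LinearMap.mul' ℂ (MvPolynomial (Fin 2) ℂ)
      (TensorProduct.map (linSubst a b c d).toLinearMap (linSubst a b c d).toLinearMap z) =
      linSubst a b c d (LinearMap.mul' ℂ (MvPolynomial (Fin 2) ℂ) z) := by
    intro z
    induction z with
    | zero => simp
    | add x y hx hy => simp only [map_add, hx, hy]
    | tmul f g => simp
  rw [transv_eq_cayleyOmega, transv_eq_cayleyOmega]
  have := hk (f ⊗ₜ g)
  rw [TensorProduct.map_tmul] at this
  simp only [AlgHom.toLinearMap_apply] at this
  rw [this, map_smul, hm, map_smul, smul_comm]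

theorem transv_smul_left (n m k : ℕ) (c : ℂ) (f g : MvPolynomial (Fin 2) ℂ) :
    transv n m k (c • f) g = c • transv n m k f g := by
  rw [transv_eq_cayleyOmega, transv_eq_cayleyOmega, ← TensorProduct.smul_tmul', map_smul,
    map_smul, smul_comm]

theorem transv_smul_right (n m k : ℕ) (c : ℂ) (f g : MvPolynomial (Fin 2) ℂ) :
    transv n m k f (c • g) = c • transv n m k f g := by
  rw [transv_eq_cayleyOmega, transv_eq_cayleyOmega, TensorProduct.tmul_smul, map_smul,
    map_smul, smul_comm]

theorem linSubst_comp (a b c d a' b' c' d' : ℂ) (f : MvPolynomial (Fin 2) ℂ) :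
    linSubst a' b' c' d' (linSubst a b c d f) =
      linSubst (a * a' + b * c') (a * b' + b * d') (c * a' + d * c') (c * b' + d * d') f := by
  induction f using MvPolynomial.induction_on with
  | C r => simp
  | add p q hp hq => simp only [map_add, hp, hq]
  | mul_X p i hp =>
    have hX : linSubst a' b' c' d' (linSubst a b c d (X i)) =
        linSubst (a * a' + b * c') (a * b' + b * d') (c * a' + d * c') (c * b' + d * d') (X i) := by
      fin_cases i <;> simp [linSubst_X_zero, linSubst_X_one] <;> ring
    rw [map_mul, map_mul, map_mul, hp, hX]

theorem linSubst_one (f : MvPolynomial (Fin 2) ℂ) : linSubst 1 0 0 1 f = f := by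
  induction f using MvPolynomial.induction_on with
  | C r => simp
  | add p q hp hq => simp only [map_add, hp, hq]
  | mul_X p i hp =>
    have hX : linSubst 1 0 0 1 (X i) = X i := by
      fin_cases i <;> simp [linSubst_X_zero, linSubst_X_one]
    rw [map_mul, hp, hX]

/-- Two binary forms are related if an invertible linear substitution takes one to the other. -/
def LinEquivalent (f g : MvPolynomial (Fin 2) ℂ) : Prop :=
  ∃ a b c d : ℂ, a * d - b * c ≠ 0 ∧ linSubst a b c d f = g

theorem LinEquivalent.refl (f : MvPolynomial (Fin 2) ℂ) : LinEquivalent f f :=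
  ⟨1, 0, 0, 1, by norm_num, linSubst_one f⟩

theorem LinEquivalent.trans {f g h : MvPolynomial (Fin 2) ℂ} (hfg : LinEquivalent f g)
    (hgh : LinEquivalent g h) : LinEquivalent f h := by
  obtain ⟨a, b, c, d, h₁, rfl⟩ := hfg
  obtain ⟨a', b', c', d', h₂, rfl⟩ := hgh
  refine ⟨_, _, _, _, ?_, (linSubst_comp a b c d a' b' c' d' f).symm⟩
  convert mul_ne_zero h₁ h₂ using 1
  ring

theorem LinEquivalent.symm {f g : MvPolynomial (Fin 2) ℂ} (hfg : LinEquivalent f g) :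
    LinEquivalent g f := by
  obtain ⟨a, b, c, d, h, rfl⟩ := hfg
  refine ⟨d / (a * d - b * c), -b / (a * d - b * c), -c / (a * d - b * c),
    a / (a * d - b * c), ?_, ?_⟩
  · have : d / (a * d - b * c) * (a / (a * d - b * c)) -
        -b / (a * d - b * c) * (-c / (a * d - b * c)) = (a * d - b * c)⁻¹ := by
      field_simp
    rw [this]
    exact inv_ne_zero h
  · rw [linSubst_comp]
    convert linSubst_one f using 3 <;>
      rw [mul_div_assoc', mul_div_assoc', ← add_div, div_eq_iff h] <;> ring

theorem isHomogeneous_linSubst_binForm (n : ℕ) (a : ℕ → ℂ) (p q r s : ℂ) :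
    (linSubst p q r s (binForm n a)).IsHomogeneous n := by
  have hX : ∀ i, (linSubst p q r s (X i)).IsHomogeneous 1 := by
    refine Fin.forall_fin_two.mpr ⟨?_, ?_⟩
    · simpa only [linSubst_X_zero] using
        (isHomogeneous_C_mul_X p 0).add (isHomogeneous_C_mul_X q 1)
    · simpa only [linSubst_X_one] using
        (isHomogeneous_C_mul_X r 0).add (isHomogeneous_C_mul_X s 1)
  rw [binForm, map_sum]
  refine IsHomogeneous.sum _ _ _ fun i hi => ?_
  rw [Finset.mem_range] at hi
  have h := (isHomogeneous_C (Fin 2) ((n.choose i : ℂ) * a i)).mul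
    (((hX 0).pow (n - i)).mul ((hX 1).pow i))
  rw [show 0 + (1 * (n - i) + 1 * i) = n by omega] at h
  simpa only [map_mul, map_pow, linSubst_C] using h

theorem HasRootOfMult.of_linEquivalent {r : ℕ} {f g : MvPolynomial (Fin 2) ℂ}
    (hfg : LinEquivalent f g) (hf : HasRootOfMult r f) : HasRootOfMult r g := by
  obtain ⟨a, b, c, d, h, rfl⟩ := hfg
  obtain ⟨α, β, hαβ, hdvd⟩ := hf
  refine ⟨α * a + β * c, α * b + β * d, ?_, ?_⟩
  · by_contra! h0
    have h1 : α * (a * d - b * c) = 0 := by linear_combination d * h0.1 - c * h0.2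
    have h2 : β * (a * d - b * c) = 0 := by linear_combination a * h0.2 - b * h0.1
    rcases hαβ with h' | h'
    · exact (mul_ne_zero h' h) h1
    · exact (mul_ne_zero h' h) h2
  · have := map_dvd (linSubst a b c d) hdvd
    convert this using 1
    simp [linSubst_X_zero, linSubst_X_one]
    ring

/-- The common vanishing of the eleven invariants. -/
def InvariantsVanish (f : MvPolynomial (Fin 2) ℂ) : Prop :=
  j2 f = 0 ∧ j4 f = 0 ∧ j6 f = 0 ∧ A6 f = 0 ∧ B6 f = 0 ∧ j8 f = 0 ∧ j9 f = 0 ∧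
    j10 f = 0 ∧ A12 f = 0 ∧ j14 f = 0 ∧ A14 f = 0

theorem covK_linSubst (a b c d : ℂ) (f : MvPolynomial (Fin 2) ℂ) :
    covK (linSubst a b c d f) = (a * d - b * c) ^ 8 • linSubst a b c d (covK f) :=
  transv_linSubst ..

theorem InvariantsVanish.of_linEquivalent {f g : MvPolynomial (Fin 2) ℂ}
    (hfg : LinEquivalent f g) (hf : InvariantsVanish f) : InvariantsVanish g := by
  obtain ⟨a, b, c, d, -, rfl⟩ := hfg
  obtain ⟨h1, h2, h3, h4, h5, h6, h7, h8, h9, h10, h11⟩ := hf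
  simp only [InvariantsVanish, j2, j4, j6, A6, B6, j8, j9, j10, A12, j14, A14, covK, covM, covQ,
    covKq, covKm, covMq] at *
  simp only [transv_linSubst, transv_smul_left, transv_smul_right, smul_pow, ← map_pow,
    h1, h2, h3, h4, h5, h6, h7, h8, h9, h10, h11, map_zero, smul_zero, and_self]

theorem linEquivalent_swap (n : ℕ) (a : ℕ → ℂ) :
    LinEquivalent (binForm n a) (binForm n fun i => a (n - i)) := by
  refine ⟨0, 1, 1, 0, by norm_num, ?_⟩
  simp only [binForm, map_sum, map_mul, map_pow, linSubst_X_zero, linSubst_X_one, linSubst_C]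
  rw [← Finset.sum_range_reflect]
  refine Finset.sum_congr rfl fun i hi => ?_
  rw [Finset.mem_range] at hi
  rw [show n + 1 - 1 - i = n - i by omega, Nat.choose_symm (by omega),
    show n - (n - i) = i by omega]
  simp only [C_0, C_1]
  ring

theorem linEquivalent_smul {n : ℕ} (hn : n ≠ 0) {c : ℂ} (hc : c ≠ 0) (a : ℕ → ℂ) :
    LinEquivalent (binForm n a) (binForm n fun i => c * a i) := by
  obtain ⟨z, rfl⟩ := IsAlgClosed.exists_pow_nat_eq c (Nat.pos_of_ne_zero hn)
  have hz : z ≠ 0 := by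
    rintro rfl
    exact hc (zero_pow hn)
  refine ⟨z, 0, 0, z, by simpa using hz, ?_⟩
  simp only [binForm, map_sum, map_mul, map_pow, linSubst_X_zero, linSubst_X_one, linSubst_C]
  refine Finset.sum_congr rfl fun i hi => ?_
  rw [Finset.mem_range] at hi
  have : (C z ^ n : MvPolynomial (Fin 2) ℂ) = C z ^ (n - i) * C z ^ i := by
    rw [← pow_add]; congr 1; omega
  simp only [C_0, this]
  ring

/-- The coefficients of a binary form after the substitution `y ↦ y + c x`. -/
noncomputable def shearCoeff (n : ℕ) (c : ℂ) (a : ℕ → ℂ) (l : ℕ) : ℂ :=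
  ∑ j ∈ Finset.range (n + 1 - l), (n - l).choose j * c ^ j * a (l + j)

theorem linEquivalent_shear (n : ℕ) (c : ℂ) (a : ℕ → ℂ) :
    LinEquivalent (binForm n a) (binForm n (shearCoeff n c a)) := by
  refine ⟨1, 0, c, 1, by norm_num, ?_⟩
  simp only [binForm, map_sum, map_mul, map_pow, linSubst_X_zero, linSubst_X_one, linSubst_C,
    C_0, C_1, zero_mul, one_mul, add_zero]
  have h1 : ∀ i, C (n.choose i : ℂ) * C (a i) * (X 0 ^ (n - i) * (C c * X 0 + X 1) ^ i) =
      ∑ l ∈ Finset.range (i + 1), (C (n.choose i * a i) * (X 0 ^ (n - i) *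
        (X 1 ^ l * (C c * X 0) ^ (i - l) * (i.choose l : MvPolynomial (Fin 2) ℂ)))) := by
    intro i
    rw [add_comm, add_pow, Finset.mul_sum, Finset.mul_sum, C_mul]
  simp only [← C_mul] at h1 ⊢
  rw [Finset.sum_congr rfl fun i _ => h1 i,
    Finset.sum_comm' (s' := fun l => Finset.Ico l (n + 1)) (t' := Finset.range (n + 1))
      (by intro x y; simp only [Finset.mem_range, Finset.mem_Ico]; omega)]
  refine Finset.sum_congr rfl fun l hl => ?_
  rw [Finset.mem_range] at hl
  rw [Finset.sum_Ico_eq_sum_range, shearCoeff, Finset.mul_sum, map_sum, Finset.sum_mul]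
  refine Finset.sum_congr rfl fun j hj => ?_
  rw [Finset.mem_range] at hj
  have hch : n.choose (l + j) * (l + j).choose l = n.choose l * (n - l).choose j := by
    rw [Nat.choose_mul (Nat.le_add_right l j), show l + j - l = j by omega]
  have hch' : (C (n.choose (l + j) : ℂ) * ((l + j).choose l : MvPolynomial (Fin 2) ℂ)) =
      C (n.choose l : ℂ) * C ((n - l).choose j : ℂ) := by
    rw [← map_natCast (C : ℂ →+* MvPolynomial (Fin 2) ℂ) ((l + j).choose l), ← C_mul, ← C_mul]
    congr 1
    exact_mod_cast hch
  rw [show l + j - l = j by omega, show n - l = (n - (l + j)) + j by omega, pow_add]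
  rw [show n - l = (n - (l + j)) + j by omega] at hch'
  simp only [C_mul, C_pow, mul_pow]
  linear_combination (C (a (l + j)) * X 0 ^ (n - (l + j)) * X 0 ^ j * C c ^ j * X 1 ^ l) * hch'

theorem eval_zero_one_binForm (n : ℕ) (a : ℕ → ℂ) : eval ![0, 1] (binForm n a) = a n := by
  rw [binForm, map_sum, Finset.sum_eq_single n]
  · simp
  · intro i hi hin
    rw [Finset.mem_range] at hi
    have : n - i ≠ 0 := by omega
    simp [this]
  · simp

theorem exists_linEquivalent_last_eq_zero {n : ℕ} (hn : n ≠ 0) (a : ℕ → ℂ) :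
    ∃ b, LinEquivalent (binForm n a) (binForm n b) ∧ b n = 0 := by
  by_cases ha : a n = 0
  · exact ⟨a, .refl _, ha⟩
  let P : Polynomial ℂ := ∑ i ∈ Finset.range (n + 1), Polynomial.monomial i (n.choose i * a i)
  have hP : P.coeff n = a n := by
    simp [P, Polynomial.coeff_monomial]
  obtain ⟨c, hc⟩ := IsAlgClosed.exists_root P (by
    intro h0
    have := Polynomial.le_degree_of_ne_zero (hP.trans_ne ha)
    rw [h0] at this
    exact hn (by exact_mod_cast Nat.le_zero.mp (by exact_mod_cast this)))
  obtain ⟨b, hb⟩ := exists_eq_binForm (isHomogeneous_linSubst_binForm n a 0 1 1 c)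
  refine ⟨b, ⟨0, 1, 1, c, by norm_num, hb⟩, ?_⟩
  rw [← eval_zero_one_binForm n b, ← hb]
  rw [Polynomial.IsRoot.def, Polynomial.eval_finsetSum] at hc
  refine Eq.trans ?_ hc
  simp [binForm, linSubst_X_zero, linSubst_X_one, Polynomial.eval_monomial]

theorem transv_binForm_eq {n m k p : ℕ} {a b c : ℕ → ℂ} (hn : k ≤ n) (hm : k ≤ m)
    (hp : n - k + (m - k) = p) (h : ∀ l ≤ p, transvCoeff n m k a b l = c l) :
    transv n m k (binForm n a) (binForm m b) = binForm p c := by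
  rw [transv_binForm hn hm, hp, binForm_congr h]

theorem binForm_mul_eq {p q r : ℕ} {a b c : ℕ → ℂ} (hr : p + q = r)
    (h : ∀ l ≤ r, mulCoeff p q a b l = c l) : binForm p a * binForm q b = binForm r c := by
  rw [binForm_mul, hr, binForm_congr h]

theorem transv_binForm_self_eq_zero_iff {n : ℕ} {a b : ℕ → ℂ} :
    transv n n n (binForm n a) (binForm n b) = 0 ↔ transvCoeff n n n a b 0 = 0 := by
  rw [transv_binForm le_rfl le_rfl, Nat.sub_self, binForm_zero_degree, C_eq_zero]

theorem transvCoeff_eq_of_covK {a k : ℕ → ℂ} (h : covK (binForm 10 a) = binForm 4 k) {l : ℕ}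
    (hl : l ≤ 4) : transvCoeff 10 10 8 a a l = k l := by
  refine binForm_inj (n := 4) ?_ hl
  rw [← h, covK, transv_binForm (by norm_num) (by norm_num)]

theorem hasRootOfMult_binForm {a : ℕ → ℂ} (h : ∀ i, 5 ≤ i → i ≤ 10 → a i = 0) :
    HasRootOfMult 6 (binForm 10 a) := by
  refine ⟨1, 0, Or.inl one_ne_zero, ?_⟩
  rw [C_1, C_0, one_mul, zero_mul, add_zero, binForm]
  refine Finset.dvd_sum fun i hi => ?_
  rw [Finset.mem_range] at hi
  rcases Nat.lt_or_ge i 5 with h5 | h5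
  · exact ((pow_dvd_pow _ (by omega)).mul_right _).mul_left _
  · simp [h i h5 (by omega)]

theorem hasRootOfMult_of_covK_eq_single_zero {a : ℕ → ℂ} {c : ℂ} (hc : c ≠ 0)
    (hK : covK (binForm 10 a) = binForm 4 (Pi.single 0 c)) (h : InvariantsVanish (binForm 10 a)) :
    HasRootOfMult 6 (binForm 10 a) := by
  have hM : covM (binForm 10 a) = binForm 6 (fun i => c * a (i + 4)) := by
    rw [covM, hK]
    refine transv_binForm_eq (by norm_num) (by norm_num) rfl fun l hl => ?_
    interval_cases l <;>
      simp [transvCoeff, mulCoeff, Finset.sum_range_succ, Nat.choose, Pi.single_apply] <;> ring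
  have hK2 : binForm 4 (Pi.single 0 c) ^ 2 = binForm 8 (Pi.single 0 (c ^ 2)) := by
    rw [pow_two]
    refine binForm_mul_eq rfl fun l hl => ?_
    interval_cases l <;>
      simp [mulCoeff, Finset.sum_range_succ, Nat.choose, Pi.single_apply, pow_two]
  have hK3 : binForm 4 (Pi.single 0 c) ^ 3 = binForm 12 (Pi.single 0 (c ^ 3)) := by
    rw [pow_succ, hK2]
    refine binForm_mul_eq rfl fun l hl => ?_
    interval_cases l <;>
      simp [mulCoeff, Finset.sum_range_succ, Nat.choose, Pi.single_apply, pow_succ]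
  obtain ⟨-, -, -, hA6, -, hj8, -, hj10, hA12, -, -⟩ := h
  have h10 : a 10 = 0 := by
    rw [A12, hM, hK, hK3, pow_two, binForm_mul, transv_binForm_self_eq_zero_iff] at hA12
    simpa [transvCoeff, mulCoeff, Finset.sum_range_succ, Nat.choose, Pi.single_apply, hc]
      using hA12
  have h9 : a 9 = 0 := by
    rw [j10, hM, hK, hK2, transv_binForm (by norm_num) (by norm_num),
      transv_binForm_self_eq_zero_iff] at hj10
    simpa [transvCoeff, mulCoeff, Finset.sum_range_succ, Nat.choose, Pi.single_apply, hc, h10]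
      using hj10
  have h8 : a 8 = 0 := by
    rw [j8, covKm, hM, hK, transv_binForm (by norm_num) (by norm_num),
      transv_binForm_self_eq_zero_iff] at hj8
    simpa [transvCoeff, mulCoeff, Finset.sum_range_succ, Nat.choose, Pi.single_apply, hc, h10, h9]
      using hj8
  have h7 : a 7 = 0 := by
    rw [A6, hM, transv_binForm_self_eq_zero_iff] at hA6
    simpa [transvCoeff, mulCoeff, Finset.sum_range_succ, Nat.choose, Pi.single_apply, hc, h10, h9,
      h8] using hA6
  have h6 : a 6 = 0 := by
    simpa [transvCoeff, mulCoeff, Finset.sum_range_succ, Nat.choose, Pi.single_apply, hc, h10, h9,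
      h8, h7] using transvCoeff_eq_of_covK hK (l := 4) (by norm_num)
  have h5 : a 5 = 0 := by
    have := transvCoeff_eq_of_covK hK (l := 2) (by norm_num)
    simp [transvCoeff, mulCoeff, Finset.sum_range_succ, Nat.choose, h10, h9, h8,
      h7, h6] at this
    exact mul_self_eq_zero.mp (by linear_combination this / 28)
  refine hasRootOfMult_binForm fun i hi hi' => ?_
  interval_cases i <;> assumption

theorem not_covK_eq_single_one {a : ℕ → ℂ} {c : ℂ} (hc : c ≠ 0)
    (hK : covK (binForm 10 a) = binForm 4 (Pi.single 1 c)) (h : InvariantsVanish (binForm 10 a)) :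
    False := by
  have hM : covM (binForm 10 a) = binForm 6 (fun i => -4 * c * a (i + 3)) := by
    rw [covM, hK]
    refine transv_binForm_eq (by norm_num) (by norm_num) rfl fun l hl => ?_
    interval_cases l <;>
      simp [transvCoeff, mulCoeff, Finset.sum_range_succ, Nat.choose, Pi.single_apply] <;> ring
  have hK2 : binForm 4 (Pi.single 1 c) ^ 2 = binForm 8 (Pi.single 2 (4 / 7 * c ^ 2)) := by
    rw [pow_two]
    refine binForm_mul_eq rfl fun l hl => ?_
    interval_cases l <;>
      simp [mulCoeff, Finset.sum_range_succ, Nat.choose, Pi.single_apply] <;>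
      ring
  have hKK : transv 4 4 2 (binForm 4 (Pi.single 1 c)) (binForm 4 (Pi.single 1 c)) =
      binForm 4 (Pi.single 0 (-2 * c ^ 2)) := by
    refine transv_binForm_eq (by norm_num) (by norm_num) rfl fun l hl => ?_
    interval_cases l <;>
      simp [transvCoeff, mulCoeff, Finset.sum_range_succ, Nat.choose, Pi.single_apply] <;>
      ring
  have hKK2 : binForm 4 (Pi.single 0 (-2 * c ^ 2)) ^ 2 = binForm 8 (Pi.single 0 (4 * c ^ 4)) := by
    rw [pow_two]
    refine binForm_mul_eq rfl fun l hl => ?_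
    interval_cases l <;>
      simp [mulCoeff, Finset.sum_range_succ, Nat.choose, Pi.single_apply] <;> ring
  obtain ⟨hj2, -, -, hA6, -, -, hj9, hj10, -, -, hA14⟩ := h
  have h9 : a 9 = 0 := by
    rw [j9, hM, hK, hK2, transv_binForm (by norm_num) (by norm_num),
      transv_binForm_self_eq_zero_iff] at hj9
    simpa [transvCoeff, mulCoeff, Finset.sum_range_succ, Nat.choose, Pi.single_apply, hc]
      using hj9
  have h8 : a 8 = 0 := by
    rw [A14, hM, hK, hKK, hKK2, transv_binForm (by norm_num) (by norm_num),
      transv_binForm_self_eq_zero_iff] at hA14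
    simpa [transvCoeff, mulCoeff, Finset.sum_range_succ, Nat.choose, Pi.single_apply, hc, h9]
      using hA14
  have h7 : a 7 = 0 := by
    rw [j10, hM, hK, hK2, transv_binForm (by norm_num) (by norm_num),
      transv_binForm_self_eq_zero_iff] at hj10
    simp [transvCoeff, mulCoeff, Finset.sum_range_succ, Nat.choose, Pi.single_apply, h9, h8]
      at hj10
    have : c * a 7 = 0 := mul_self_eq_zero.mp (by
      linear_combination (-7 / 80) * hj10.resolve_right hc)
    simpa [hc] using this
  have h6 : a 6 = 0 := by
    rw [A6, hM, transv_binForm_self_eq_zero_iff] at hA6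
    simpa [transvCoeff, mulCoeff, Finset.sum_range_succ, Nat.choose, hc, h9, h8, h7] using hA6
  have e2 := transvCoeff_eq_of_covK hK (l := 2) (by norm_num)
  have e1 := transvCoeff_eq_of_covK hK (l := 1) (by norm_num)
  rw [j2, transv_binForm_self_eq_zero_iff] at hj2
  simp [transvCoeff, mulCoeff, Finset.sum_range_succ, Nat.choose, h9, h8, h7, h6] at e1 e2 hj2
  have h5 : a 5 = 0 := mul_self_eq_zero.mp (by linear_combination (e2 - hj2 / 6) / 70)
  exact hc (by simpa [h5] using e1.symm)

/-- The vanishing of the two basic invariants of a binary quartic. -/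
def QuarticInvariantsVanish (f : MvPolynomial (Fin 2) ℂ) : Prop :=
  transv 4 4 4 f f = 0 ∧ transv 4 4 4 (transv 4 4 2 f f) f = 0

theorem QuarticInvariantsVanish.of_linEquivalent {f g : MvPolynomial (Fin 2) ℂ}
    (hfg : LinEquivalent f g) (hf : QuarticInvariantsVanish f) : QuarticInvariantsVanish g := by
  obtain ⟨a, b, c, d, -, rfl⟩ := hfg
  simp only [QuarticInvariantsVanish, transv_linSubst, transv_smul_left, hf.1, hf.2, map_zero,
    smul_zero, and_self]

theorem QuarticInvariantsVanish.coeff_eq {k : ℕ → ℂ}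
    (h : QuarticInvariantsVanish (binForm 4 k)) :
    k 0 * k 4 - 4 * k 1 * k 3 + 3 * k 2 ^ 2 = 0 ∧
      k 0 * k 2 * k 4 + 2 * k 1 * k 2 * k 3 - k 2 ^ 3 - k 0 * k 3 ^ 2 - k 1 ^ 2 * k 4 = 0 := by
  obtain ⟨h1, h2⟩ := h
  rw [transv_binForm_self_eq_zero_iff] at h1
  rw [transv_binForm (by norm_num) (by norm_num), transv_binForm_self_eq_zero_iff] at h2
  simp [transvCoeff, mulCoeff, Finset.sum_range_succ, Nat.choose] at h1 h2
  exact ⟨by linear_combination h1 / 2, by linear_combination h2 / 6⟩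

theorem exists_linEquivalent_single {k : ℕ → ℂ} (h : QuarticInvariantsVanish (binForm 4 k)) :
    ∃ c, LinEquivalent (binForm 4 k) (binForm 4 (Pi.single 0 c)) ∨
      LinEquivalent (binForm 4 k) (binForm 4 (Pi.single 1 c)) := by
  obtain ⟨b, hkb, hb4⟩ := exists_linEquivalent_last_eq_zero (n := 4) (by norm_num) k
  obtain ⟨e4, e6⟩ := (h.of_linEquivalent hkb).coeff_eq
  by_cases hb3 : b 3 = 0
  · have hb2 : b 2 = 0 := by simpa [hb3, hb4] using e4
    by_cases hb1 : b 1 = 0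
    · refine ⟨b 0, Or.inl (hkb.trans ?_)⟩
      rw [show binForm 4 b = binForm 4 (Pi.single 0 (b 0)) from binForm_congr fun i hi => by
        interval_cases i <;> simp [hb1, hb2, hb3, hb4]]
      exact .refl _
    · refine ⟨b 1, Or.inr (hkb.trans ?_)⟩
      convert linEquivalent_shear 4 (-b 0 / (4 * b 1)) b using 1
      refine binForm_congr fun i hi => ?_
      interval_cases i <;>
        simp [shearCoeff, Finset.sum_range_succ, Nat.choose, hb2, hb3, hb4]
      field_simp
      ring
  · have hs := linEquivalent_shear 4 (-b 2 / (2 * b 3)) b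
    obtain ⟨e4', e6'⟩ := (h.of_linEquivalent (hkb.trans hs)).coeff_eq
    set b' := shearCoeff 4 (-b 2 / (2 * b 3)) b with hb'
    have hb4' : b' 4 = 0 := by simp [hb', shearCoeff, hb4]
    have hb3' : b' 3 = b 3 := by simp [hb', shearCoeff, Finset.sum_range_succ, hb4]
    have hb2' : b' 2 = 0 := by
      simp [hb', shearCoeff, Finset.sum_range_succ, hb4]
      field_simp
      ring
    have hb1' : b' 1 = 0 := by simpa [hb4', hb3', hb2', hb3] using e4'
    have hb0' : b' 0 = 0 := by simpa [hb4', hb3', hb2', hb3, hb1'] using e6'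
    refine ⟨b 3, Or.inr ((hkb.trans hs).trans ?_)⟩
    convert linEquivalent_swap 4 b' using 1
    refine binForm_congr fun i hi => ?_
    interval_cases i <;> simp [hb0', hb1', hb2', hb3', hb4']

theorem coeff_eq_of_covK_eq_zero {a : ℕ → ℂ} (hK : covK (binForm 10 a) = 0) :
    a 0 * a 8 - 8 * a 1 * a 7 + 28 * a 2 * a 6 - 56 * a 3 * a 5 + 35 * a 4 ^ 2 = 0 ∧
    a 0 * a 9 - 7 * a 1 * a 8 + 20 * a 2 * a 7 - 28 * a 3 * a 6 + 14 * a 4 * a 5 = 0 ∧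
    a 0 * a 10 - 4 * a 1 * a 9 - 3 * a 2 * a 8 + 48 * a 3 * a 7 - 126 * a 4 * a 6 +
      84 * a 5 ^ 2 = 0 ∧
    a 1 * a 10 - 7 * a 2 * a 9 + 20 * a 3 * a 8 - 28 * a 4 * a 7 + 14 * a 5 * a 6 = 0 ∧
    a 2 * a 10 - 8 * a 3 * a 9 + 28 * a 4 * a 8 - 56 * a 5 * a 7 + 35 * a 6 ^ 2 = 0 := by
  have hK' : covK (binForm 10 a) = binForm 4 (fun _ => 0) := by
    rw [hK]
    simp [binForm]
  have h0 := transvCoeff_eq_of_covK hK' (l := 0) (by norm_num)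
  have h1 := transvCoeff_eq_of_covK hK' (l := 1) (by norm_num)
  have h2 := transvCoeff_eq_of_covK hK' (l := 2) (by norm_num)
  have h3 := transvCoeff_eq_of_covK hK' (l := 3) (by norm_num)
  have h4 := transvCoeff_eq_of_covK hK' (l := 4) (by norm_num)
  simp [transvCoeff, mulCoeff, Finset.sum_range_succ, Nat.choose] at h0 h1 h2 h3 h4
  exact ⟨by linear_combination h0 / 2, by linear_combination h1, by linear_combination 3 * h2,
    by linear_combination h3, by linear_combination h4 / 2⟩

theorem coeff_eq_of_j2_eq_zero {a : ℕ → ℂ} (h : j2 (binForm 10 a) = 0) :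
    a 0 * a 10 - 10 * a 1 * a 9 + 45 * a 2 * a 8 - 120 * a 3 * a 7 + 210 * a 4 * a 6 -
      126 * a 5 ^ 2 = 0 := by
  rw [j2, transv_binForm_self_eq_zero_iff] at h
  simp [transvCoeff, mulCoeff, Finset.sum_range_succ, Nat.choose] at h
  linear_combination h / 2

theorem hasRootOfMult_binForm_of_mulCoeff {a : ℕ → ℂ} (e : ℂ) (g : ℕ → ℂ)
    (h : ∀ i ≤ 10, mulCoeff 6 4 (fun i => e ^ (6 - i)) g i = a i) :
    HasRootOfMult 6 (binForm 10 a) := by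
  refine ⟨e, 1, Or.inr one_ne_zero, binForm 4 g, ?_⟩
  rw [← binForm_mul_eq (p := 6) (q := 4) rfl h]
  congr 1
  simp [binForm, Finset.sum_range_succ, Nat.choose]
  ring

theorem hasRootOfMult_of_nullform_one {a : ℕ → ℂ} {s e : ℂ} (h10 : a 10 = 0) (h9 : a 9 = 1)
    (h8 : a 8 = 0) (h7 : a 7 = s) (h6 : a 6 = 4 * e ^ 3 + 4 * e * s)
    (h5 : a 5 = 15 * e ^ 4 + 10 * e ^ 2 * s) (h4 : a 4 = 36 * e ^ 5 + 20 * e ^ 3 * s)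
    (h3 : a 3 = 70 * e ^ 6 + 35 * e ^ 4 * s) (h2 : a 2 = 120 * e ^ 7 + 56 * e ^ 5 * s)
    (h1 : a 1 = 189 * e ^ 8 + 84 * e ^ 6 * s) (h0 : a 0 = 280 * e ^ 9 + 120 * e ^ 7 * s) :
    HasRootOfMult 6 (binForm 10 a) := by
  refine hasRootOfMult_binForm_of_mulCoeff e (fun i =>
    if i = 0 then 280 * e ^ 3 + 120 * e * s else if i = 1 then 105 / 2 * e ^ 2 + 30 * s
    else if i = 2 then -10 * e else if i = 3 then 5 / 2 else 0) fun i hi => ?_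
  interval_cases i <;>
    simp [mulCoeff, Finset.sum_range_succ, Nat.choose, h0, h1, h2, h3, h4, h5, h6, h7,
      h8, h9, h10] <;>
    ring

theorem hasRootOfMult_of_nullform_two {a : ℕ → ℂ} {e : ℂ} (h10 : a 10 = 0) (h9 : a 9 = 0)
    (h8 : a 8 = 1) (h7 : a 7 = 0) (h6 : a 6 = -6 * e ^ 2)
    (h5 : a 5 = -20 * e ^ 3) (h4 : a 4 = -45 * e ^ 4)
    (h3 : a 3 = -84 * e ^ 5) (h2 : a 2 = -140 * e ^ 6)
    (h1 : a 1 = -216 * e ^ 7) (h0 : a 0 = -315 * e ^ 8) :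
    HasRootOfMult 6 (binForm 10 a) := by
  refine hasRootOfMult_binForm_of_mulCoeff e (fun i =>
    if i = 0 then -315 * e ^ 2 else if i = 1 then -135 / 2 * e else if i = 2 then 15 / 2 else 0)
    fun i hi => ?_
  interval_cases i <;>
    simp [mulCoeff, Finset.sum_range_succ, Nat.choose, h0, h1, h2, h3, h4, h5, h6, h7,
      h8, h9, h10] <;>
    ring

theorem hasRootOfMult_of_apply_eight {a : ℕ → ℂ} (hK : covK (binForm 10 a) = 0)
    (hj2 : j2 (binForm 10 a) = 0) (h10 : a 10 = 0) (h9 : a 9 = 0) (h8 : a 8 = 1)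
    (h7 : a 7 = 0) : HasRootOfMult 6 (binForm 10 a) := by
  obtain ⟨k0, k1, k2, k3, k4⟩ := coeff_eq_of_covK_eq_zero hK
  have k := coeff_eq_of_j2_eq_zero hj2
  simp only [h10, h9, h8, h7] at k0 k1 k2 k3 k4 k
  have h4 : a 4 = -5 / 4 * a 6 ^ 2 := by linear_combination k4 / 28
  have h3 : a 3 = -7 / 10 * a 5 * a 6 := by linear_combination k3 / 20
  have h2 : a 2 = 105 / 2 * a 6 ^ 3 + 28 * a 5 ^ 2 := by
    rw [h4] at k2
    linear_combination -k2 / 3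
  have h1 : a 1 = 3 / 10 * a 5 * a 6 ^ 2 := by
    rw [h3, h4] at k1
    linear_combination -k1 / 7
  have hrel : 50 * a 6 ^ 3 + 27 * a 5 ^ 2 = 0 := by
    rw [h4, h2] at k
    linear_combination k / 42
  obtain ⟨e, he⟩ := IsAlgClosed.exists_pow_nat_eq (-a 6 / 6) (n := 2) (by norm_num)
  have h6 : a 6 = -6 * e ^ 2 := by linear_combination 6 * he
  have h5 : (a 5 - -20 * e ^ 3) * (a 5 - -20 * (-e) ^ 3) = 0 := by
    rw [h6] at hrel
    linear_combination hrel / 27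
  have h0 : a 0 = -28 * a 2 * a 6 + 56 * a 3 * a 5 - 35 * a 4 ^ 2 := by linear_combination k0
  rcases mul_eq_zero.mp h5 with h | h
  · refine hasRootOfMult_of_nullform_two (e := e) h10 h9 h8 h7 h6 (sub_eq_zero.mp h) ?_ ?_ ?_ ?_ ?_
    all_goals
      simp only [h0, h1, h2, h3, h4, h6, sub_eq_zero.mp h]
      ring
  · refine hasRootOfMult_of_nullform_two (e := -e) h10 h9 h8 h7 (by rw [h6]; ring)
      (sub_eq_zero.mp h) ?_ ?_ ?_ ?_ ?_
    all_goals
      simp only [h0, h1, h2, h3, h4, h6, sub_eq_zero.mp h]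
      ring

theorem hasRootOfMult_of_apply_seven {a : ℕ → ℂ} (hK : covK (binForm 10 a) = 0)
    (hj14 : j14 (binForm 10 a) = 0) (h10 : a 10 = 0) (h9 : a 9 = 0) (h8 : a 8 = 0)
    (h7 : a 7 ≠ 0) (h6 : a 6 = 0) : HasRootOfMult 6 (binForm 10 a) := by
  obtain ⟨k0, k1, k2, k3, k4⟩ := coeff_eq_of_covK_eq_zero hK
  have h5 : a 5 = 0 := by simpa [h10, h9, h8, h7, h6] using k4
  have h4 : a 4 = 0 := by simpa [h10, h9, h8, h7, h6, h5] using k3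
  have h3 : a 3 = 0 := by simpa [h10, h9, h8, h7, h6, h5, h4] using k2
  have h2 : a 2 = 0 := by simpa [h10, h9, h8, h7, h6, h5, h4, h3] using k1
  have h1 : a 1 = 0 := by simpa [h10, h9, h8, h7, h6, h5, h4, h3, h2] using k0
  have h0 : a 0 = 0 := by
    have hQ : covQ (binForm 10 a) =
        binForm 8 (fun i => if i = 1 then a 0 * a 7 else if i = 8 then -20 * a 7 ^ 2 else 0) := by
      refine transv_binForm_eq (by norm_num) (by norm_num) rfl fun l hl => ?_
      interval_cases l <;>
        simp [transvCoeff, mulCoeff, Finset.sum_range_succ, Nat.choose, h1, h2, h3,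
          h4, h5, h6, h8, h9, h10] <;>
        ring
    have hKq : covKq (binForm 10 a) = binForm 4 (Pi.single 3 (-20 * a 0 * a 7 ^ 3)) := by
      rw [covKq, hQ]
      refine transv_binForm_eq (by norm_num) (by norm_num) rfl fun l hl => ?_
      interval_cases l <;>
        simp [transvCoeff, mulCoeff, Finset.sum_range_succ, Nat.choose] <;> ring
    have hMq : covMq (binForm 10 a) = binForm 4 (Pi.single 0 (80 * a 0 ^ 2 * a 7 ^ 4)) := by
      rw [covMq, hQ, hKq]
      refine transv_binForm_eq (by norm_num) (by norm_num) rfl fun l hl => ?_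
      interval_cases l <;>
        simp [transvCoeff, mulCoeff, Finset.sum_range_succ, Nat.choose, Pi.single_apply] <;> ring
    rw [j14, hMq, hKq, transv_binForm (by norm_num) (by norm_num),
      transv_binForm_self_eq_zero_iff] at hj14
    simpa [transvCoeff, mulCoeff, Finset.sum_range_succ, Nat.choose, Pi.single_apply, h7]
      using hj14
  refine ⟨0, 1, Or.inr one_ne_zero, 120 * C (a 7) * X 0 ^ 3 * X 1, ?_⟩
  simp [binForm, Finset.sum_range_succ, Nat.choose, h0, h1, h2, h3, h4, h5, h6, h8, h9, h10]
  ring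

theorem nullform_relation_of_apply_five_eq_zero {a : ℕ → ℂ} {s r : ℂ} (hr : r ≠ 0)
    (hB6 : B6 (binForm 10 a) = 0) (hj14 : j14 (binForm 10 a) = 0)
    (h10 : a 10 = 0) (h9 : a 9 = 1) (h8 : a 8 = 0) (h7 : a 7 = s) (h6 : a 6 = r) (h5 : a 5 = 0)
    (h4 : a 4 = 2 * s * r) (h3 : a 3 = 35 / 8 * r ^ 2) (h2 : a 2 = -8 * s ^ 2 * r)
    (h1 : a 1 = -21 / 2 * s * r ^ 2) (h0 : a 0 = 160 * s ^ 3 * r + 245 / 2 * r ^ 3) :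
    32 * s ^ 3 + 27 * r ^ 2 = 0 := by
  obtain ⟨q, hQ, q0, q1, q2, q3, q4, q5, q6, q7, q8⟩ :
      ∃ q, covQ (binForm 10 a) = binForm 8 q ∧
        q 0 = -160 * s ^ 3 * r ^ 2 - 2205 / 16 * r ^ 4 ∧
        q 1 = 160 * s ^ 4 * r + 525 / 4 * s * r ^ 3 ∧
        q 2 = -5 * s ^ 2 * r ^ 2 ∧
        q 3 = 40 * s ^ 3 * r + 315 / 8 * r ^ 3 ∧
        q 4 = 15 / 2 * s * r ^ 2 ∧
        q 5 = 10 * s ^ 2 * r ∧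
        q 6 = -45 / 4 * r ^ 2 ∧
        q 7 = -15 * s * r ∧
        q 8 = -20 * s ^ 2 := by
    refine ⟨_, transv_binForm (by norm_num) (by norm_num) a a, ?_⟩
    simp [transvCoeff, mulCoeff, Finset.sum_range_succ, Nat.choose, h0, h1, h2, h3, h4, h5, h6,
      h7, h8, h9, h10]
    ring_nf
    simp
  obtain ⟨k, hKq, k0, k1, k2, k3, k4⟩ :
      ∃ k, covKq (binForm 10 a) = binForm 4 k ∧
        k 0 = -51200 * s ^ 6 * r ^ 2 - 76275 * s ^ 3 * r ^ 4 - 893025 / 32 * r ^ 6 ∧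
        k 1 = 9450 * s ^ 4 * r ^ 3 + 127575 / 16 * s * r ^ 5 ∧
        k 2 = 7200 * s ^ 5 * r ^ 2 + 6075 * s ^ 2 * r ^ 4 ∧
        k 3 = -3200 * s ^ 6 * r - 7425 * s ^ 3 * r ^ 3 - 127575 / 32 * r ^ 5 ∧
        k 4 = 5400 * s ^ 4 * r ^ 2 + 18225 / 4 * s * r ^ 4 := by
    rw [covKq, hQ]
    refine ⟨_, transv_binForm (by norm_num) (by norm_num) q q, ?_⟩
    simp [transvCoeff, mulCoeff, Finset.sum_range_succ, Nat.choose]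
    simp only [q0, q1, q2, q3, q4, q5, q6, q7, q8]
    ring_nf
    simp
  obtain ⟨m, hMq, m0, m1, m2, m3, m4⟩ :
      ∃ m, covMq (binForm 10 a) = binForm 4 m ∧
        m 0 = 2048000 * s ^ 10 * r ^ 2 + 3456000 * s ^ 7 * r ^ 4 + 1458000 * s ^ 4 * r ^ 6 ∧
        m 1 = 2016000 * s ^ 8 * r ^ 3 + 3402000 * s ^ 5 * r ^ 5 + 5740875 / 4 * s ^ 2 * r ^ 7 ∧
        m 2 = 512000 * s ^ 9 * r ^ 2 + 2187000 * s ^ 6 * r ^ 4 + 5194125 / 2 * s ^ 3 * r ^ 6 +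
          120558375 / 128 * r ^ 8 ∧
        m 3 = 1512000 * s ^ 7 * r ^ 3 + 2551500 * s ^ 4 * r ^ 5 + 17222625 / 16 * s * r ^ 7 ∧
        m 4 = 1152000 * s ^ 8 * r ^ 2 + 1944000 * s ^ 5 * r ^ 4 + 820125 * s ^ 2 * r ^ 6 := by
    rw [covMq, hQ, hKq]
    refine ⟨_, transv_binForm (by norm_num) (by norm_num) q k, ?_⟩
    simp [transvCoeff, mulCoeff, Finset.sum_range_succ, Nat.choose]
    simp only [q0, q1, q2, q3, q4, q5, q6, q7, q8, k0, k1, k2, k3, k4]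
    ring_nf
    simp
  obtain ⟨p, hP, p0, p1, p2, p3, p4, p5, p6, p7, p8⟩ :
      ∃ p, transv 8 8 4 (binForm 8 q) (binForm 8 q) = binForm 8 p ∧
        p 0 = -51200 * s ^ 7 * r ^ 2 - 94650 * s ^ 4 * r ^ 4 - 694575 / 16 * s * r ^ 6 ∧
        p 1 = -5600 * s ^ 5 * r ^ 3 - 4725 * s ^ 2 * r ^ 5 ∧
        p 2 = 12800 / 7 * s ^ 6 * r ^ 2 + 76725 / 14 * s ^ 3 * r ^ 4 + 212625 / 64 * r ^ 6 ∧
        p 3 = 300 * s ^ 4 * r ^ 3 + 2025 / 8 * s * r ^ 5 ∧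
        p 4 = -8000 / 7 * s ^ 5 * r ^ 2 - 6750 / 7 * s ^ 2 * r ^ 4 ∧
        p 5 = -3200 / 7 * s ^ 6 * r + 3600 / 7 * s ^ 3 * r ^ 3 + 6075 / 8 * r ^ 5 ∧
        p 6 = 3900 / 7 * s ^ 4 * r ^ 2 + 26325 / 56 * s * r ^ 4 ∧
        p 7 = -800 * s ^ 5 * r - 675 * s ^ 2 * r ^ 3 ∧
        p 8 = 900 * s ^ 3 * r ^ 2 + 6075 / 8 * r ^ 4 := by
    refine ⟨_, transv_binForm (by norm_num) (by norm_num) q q, ?_⟩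
    simp [transvCoeff, mulCoeff, Finset.sum_range_succ, Nat.choose]
    simp only [q0, q1, q2, q3, q4, q5, q6, q7, q8]
    ring_nf
    simp
  rw [B6, hQ, hP, transv_binForm_self_eq_zero_iff] at hB6
  simp [transvCoeff, mulCoeff, Finset.sum_range_succ, Nat.choose] at hB6
  simp only [p0, p1, p2, p3, p4, p5, p6, p7, p8, q0, q1, q2, q3, q4, q5, q6, q7, q8] at hB6
  rw [j14, hMq, hKq, transv_binForm (by norm_num) (by norm_num),
    transv_binForm_self_eq_zero_iff] at hj14
  simp [transvCoeff, mulCoeff, Finset.sum_range_succ, Nat.choose] at hj14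
  simp only [k0, k1, k2, k3, k4, m0, m1, m2, m3, m4] at hj14
  have eB : r ^ 2 * ((32 * s ^ 3 + 27 * r ^ 2) ^ 2 * (3000 * s ^ 3 - 496125 / 128 * r ^ 2)) = 0 := by
    linear_combination hB6
  have eJ : r ^ 4 * ((32 * s ^ 3 + 27 * r ^ 2) ^ 4 *
      (s * (40000000 * s ^ 9 + 2379375000 * s ^ 6 * r ^ 2 + 293023828125 / 64 * s ^ 3 * r ^ 4 +
        25844701640625 / 16384 * r ^ 6))) = 0 := by
    linear_combination -hj14
  by_contra hne
  replace eB : 3000 * s ^ 3 - 496125 / 128 * r ^ 2 = 0 := by simpa [hr, hne] using eB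
  have hs3 : s ^ 3 = 1323 / 1024 * r ^ 2 := by linear_combination eB / 3000
  have hs : s ≠ 0 := by
    rintro rfl
    apply hr
    simpa using hs3
  have eJ' : s * r ^ 6 = 0 := by
    have : s * (40000000 * s ^ 9 + 2379375000 * s ^ 6 * r ^ 2 +
        293023828125 / 64 * s ^ 3 * r ^ 4 + 25844701640625 / 16384 * r ^ 6) = 0 := by
      simpa only [mul_eq_zero, pow_eq_zero_iff, hr, hne, ne_eq, OfNat.ofNat_ne_zero,
        not_false_eq_true, false_or] using eJ
    rw [show s ^ 9 = (s ^ 3) ^ 3 by ring, show s ^ 6 = (s ^ 3) ^ 2 by ring, hs3] at this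
    linear_combination (2097152 / 24223869637734375) * this
  simp [hr, hs] at eJ'

theorem exists_nullform_parameter {s r q p : ℂ}
    (h1 : 80 * s ^ 2 * q - 50 * s * r ^ 2 + 25 * r * p - 16 * q ^ 2 = 0)
    (h2 : 96 * s ^ 3 * q - 60 * s ^ 2 * r ^ 2 + 20 * s * r * p + 32 * s * q ^ 2 - 27 * r ^ 2 * q +
      5 * p ^ 2 = 0)
    (h3 : r ≠ 0 → q = 0 → p = 2 * s * r → 32 * s ^ 3 + 27 * r ^ 2 = 0) :
    ∃ e : ℂ, r = 4 * e ^ 3 + 4 * e * s ∧ q = 15 * e ^ 4 + 10 * e ^ 2 * s ∧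
      p = 36 * e ^ 5 + 20 * e ^ 3 * s := by
  by_cases hr : r = 0
  · subst hr
    have hq : q * (q - 5 * s ^ 2) = 0 := by linear_combination -h1 / 16
    rcases mul_eq_zero.mp hq with hq | hq
    · subst hq
      exact ⟨0, by simp, by simp, by simpa using h2⟩
    · rw [sub_eq_zero] at hq
      subst hq
      obtain ⟨e, he⟩ := IsAlgClosed.exists_pow_nat_eq (-s) (n := 2) (by norm_num)
      obtain rfl : s = -e ^ 2 := by linear_combination he
      have hp : (p - 16 * e ^ 5) * (p - 16 * (-e) ^ 5) = 0 := by linear_combination h2 / 5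
      rcases mul_eq_zero.mp hp with hp | hp
      · exact ⟨e, by ring, by ring, by linear_combination hp⟩
      · exact ⟨-e, by ring, by ring, by linear_combination hp⟩
  · suffices ∃ E, 15 * E ^ 2 + 10 * s * E = q ∧ r ^ 2 = 16 * E * (E + s) ^ 2 by
      obtain ⟨E, hq, hE⟩ := this
      obtain ⟨e, rfl⟩ := IsAlgClosed.exists_pow_nat_eq E (n := 2) (by norm_num)
      have hr' : (r - (4 * e ^ 3 + 4 * e * s)) * (r - (4 * (-e) ^ 3 + 4 * (-e) * s)) = 0 := by
        linear_combination hE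
      have key : ∀ e : ℂ, r = 4 * e ^ 3 + 4 * e * s → q = 15 * e ^ 4 + 10 * e ^ 2 * s →
          p = 36 * e ^ 5 + 20 * e ^ 3 * s := by
        intro e he hq
        refine mul_left_cancel₀ hr ?_
        rw [hq] at h1
        rw [he] at h1 ⊢
        linear_combination h1 / 25
      rcases mul_eq_zero.mp hr' with h | h
      · have hr1 : r = 4 * e ^ 3 + 4 * e * s := by linear_combination h
        have hq1 : q = 15 * e ^ 4 + 10 * e ^ 2 * s := by linear_combination -hq
        exact ⟨e, hr1, hq1, key e hr1 hq1⟩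
      · have hr1 : r = 4 * (-e) ^ 3 + 4 * (-e) * s := by linear_combination h
        have hq1 : q = 15 * (-e) ^ 4 + 10 * (-e) ^ 2 * s := by linear_combination -hq
        exact ⟨-e, hr1, hq1, key (-e) hr1 hq1⟩
    by_cases hq : q = 0
    · subst hq
      have hp : p = 2 * s * r := mul_left_cancel₀ hr (by linear_combination h1 / 25)
      have := h3 hr rfl hp
      exact ⟨-2 * s / 3, by ring, by linear_combination this / 27⟩
    · obtain ⟨w, hw⟩ := IsAlgClosed.exists_pow_nat_eq (25 * s ^ 2 + 15 * q) (n := 2) (by norm_num)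
      have hfac : (r ^ 2 - 16 * ((w - 5 * s) / 15) * ((w - 5 * s) / 15 + s) ^ 2) *
          (r ^ 2 - 16 * ((-w - 5 * s) / 15) * ((-w - 5 * s) / 15 + s) ^ 2) = 0 := by
        have hq' : q = (w ^ 2 - 25 * s ^ 2) / 15 := by linear_combination -hw / 15
        refine mul_left_cancel₀ hq ?_
        have hT : r * p = 16 / 25 * q ^ 2 - 16 / 5 * s ^ 2 * q + 2 * s * r ^ 2 := by
          linear_combination h1 / 25
        have hrel : q * (-27 * (r ^ 2) ^ 2 + (288 / 5 * s * q - 32 * s ^ 3) * r ^ 2 +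
            256 / 125 * q * (q - 5 * s ^ 2) ^ 2) = 0 := by
          linear_combination r ^ 2 * h2 - (20 * s * r ^ 2 + 5 * (r * p +
            (16 / 25 * q ^ 2 - 16 / 5 * s ^ 2 * q + 2 * s * r ^ 2))) * hT
        rw [hq'] at hrel ⊢
        linear_combination -hrel / 27
      rcases mul_eq_zero.mp hfac with h | h
      · exact ⟨(w - 5 * s) / 15, by linear_combination hw / 15, by linear_combination h⟩
      · exact ⟨(-w - 5 * s) / 15, by linear_combination hw / 15, by linear_combination h⟩

theorem hasRootOfMult_of_apply_nine {a : ℕ → ℂ} (hK : covK (binForm 10 a) = 0)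
    (hj2 : j2 (binForm 10 a) = 0) (hB6 : B6 (binForm 10 a) = 0) (hj14 : j14 (binForm 10 a) = 0)
    (h10 : a 10 = 0) (h9 : a 9 = 1) (h8 : a 8 = 0) : HasRootOfMult 6 (binForm 10 a) := by
  obtain ⟨k0, k1, k2, k3, k4⟩ := coeff_eq_of_covK_eq_zero hK
  have k := coeff_eq_of_j2_eq_zero hj2
  simp only [h10, h9, h8] at k0 k1 k2 k3 k4 k
  have h3 : a 3 = 35 / 8 * a 6 ^ 2 - 7 * a 7 * a 5 := by linear_combination -k4 / 8
  have h2 : a 2 = 2 * a 6 * a 5 - 4 * a 7 * a 4 := by linear_combination -k3 / 7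
  have h1 : a 1 = 3 / 4 * (16 * a 7 * a 3 - 42 * a 6 * a 4 + 28 * a 5 ^ 2) := by
    linear_combination -k2 / 4
  have h0 : a 0 = -(20 * a 7 * a 2 - 28 * a 6 * a 3 + 14 * a 5 * a 4) := by linear_combination k1
  have e1 : 80 * a 7 ^ 2 * a 5 - 50 * a 7 * a 6 ^ 2 + 25 * a 6 * a 4 - 16 * a 5 ^ 2 = 0 := by
    rw [h1, h3] at k
    linear_combination k / 21
  have e2 : 96 * a 7 ^ 3 * a 5 - 60 * a 7 ^ 2 * a 6 ^ 2 + 20 * a 7 * a 6 * a 4 +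
      32 * a 7 * a 5 ^ 2 - 27 * a 6 ^ 2 * a 5 + 5 * a 4 ^ 2 = 0 := by
    rw [h1, h2, h3] at k0
    linear_combination k0 / 7
  obtain ⟨e, h6, h5, h4⟩ := exists_nullform_parameter e1 e2 fun hr hq hp => by
    refine nullform_relation_of_apply_five_eq_zero hr hB6 hj14 h10 h9 h8 rfl rfl hq hp ?_ ?_ ?_ ?_
    all_goals
      simp only [h0, h1, h2, h3, hq, hp]
      ring
  refine hasRootOfMult_of_nullform_one h10 h9 h8 rfl h6 h5 h4 ?_ ?_ ?_ ?_
  all_goals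
    simp only [h0, h1, h2, h3, h4, h5, h6]
    ring

theorem covK_eq_zero_of_linEquivalent {f g : MvPolynomial (Fin 2) ℂ} (hfg : LinEquivalent f g)
    (hf : covK f = 0) : covK g = 0 := by
  obtain ⟨a, b, c, d, -, rfl⟩ := hfg
  rw [covK_linSubst, hf, map_zero, smul_zero]

theorem hasRootOfMult_of_covK_eq_zero {a : ℕ → ℂ} (hK : covK (binForm 10 a) = 0)
    (h : InvariantsVanish (binForm 10 a)) : HasRootOfMult 6 (binForm 10 a) := by
  have transfer : ∀ {b : ℕ → ℂ}, LinEquivalent (binForm 10 a) (binForm 10 b) →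
      (covK (binForm 10 b) = 0 → InvariantsVanish (binForm 10 b) →
        HasRootOfMult 6 (binForm 10 b)) → HasRootOfMult 6 (binForm 10 a) := fun hab hb =>
    .of_linEquivalent hab.symm (hb (covK_eq_zero_of_linEquivalent hab hK) (h.of_linEquivalent hab))
  obtain ⟨b, hab, hb10⟩ := exists_linEquivalent_last_eq_zero (n := 10) (by norm_num) a
  by_cases hb9 : b 9 = 0
  · by_cases hb8 : b 8 = 0
    · by_cases hb7 : b 7 = 0
      · refine transfer hab fun hK _ => ?_
        obtain ⟨-, -, k2, -, k4⟩ := coeff_eq_of_covK_eq_zero hK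
        have hb6 : b 6 = 0 := by simpa [hb10, hb9, hb8, hb7] using k4
        have hb5 : b 5 = 0 := by simpa [hb10, hb9, hb8, hb7, hb6] using k2
        refine hasRootOfMult_binForm fun i hi hi' => ?_
        interval_cases i <;> assumption
      · refine transfer (hab.trans (linEquivalent_shear 10 (-b 6 / (4 * b 7)) b)) fun hK h => ?_
        obtain ⟨-, -, -, -, -, -, -, -, -, hj14, -⟩ := h
        refine hasRootOfMult_of_apply_seven hK hj14 ?_ ?_ ?_ ?_ ?_
        all_goals simp [shearCoeff, Finset.sum_range_succ, Nat.choose, hb10, hb9, hb8]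
        · exact hb7
        · field_simp
          ring
    · refine transfer ((hab.trans (linEquivalent_shear 10 (-b 7 / (3 * b 8)) b)).trans
        (linEquivalent_smul (by norm_num) (inv_ne_zero hb8) _)) fun hK h => ?_
      refine hasRootOfMult_of_apply_eight hK h.1 ?_ ?_ ?_ ?_
      all_goals simp [shearCoeff, Finset.sum_range_succ, Nat.choose, hb10, hb9, hb8]
      field_simp
      ring
  · refine transfer ((hab.trans (linEquivalent_shear 10 (-b 8 / (2 * b 9)) b)).trans
      (linEquivalent_smul (by norm_num) (inv_ne_zero hb9) _)) fun hK h => ?_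
    obtain ⟨hj2, -, -, -, hB6, -, -, -, -, hj14, -⟩ := h
    refine hasRootOfMult_of_apply_nine hK hj2 hB6 hj14 ?_ ?_ ?_
    all_goals simp [shearCoeff, Finset.sum_range_succ, Nat.choose, hb10, hb9]
    field_simp
    ring

theorem hasRootOfMult_of_invariantsVanish {a : ℕ → ℂ} (h : InvariantsVanish (binForm 10 a)) :
    HasRootOfMult 6 (binForm 10 a) := by
  have hK : covK (binForm 10 a) = binForm 4 (transvCoeff 10 10 8 a a) :=
    transv_binForm (by norm_num) (by norm_num) a a
  have hquartic : QuarticInvariantsVanish (binForm 4 (transvCoeff 10 10 8 a a)) := by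
    rw [← hK]
    exact ⟨h.2.1, h.2.2.1⟩
  have transfer : ∀ (i : ℕ) (c : ℂ), LinEquivalent (binForm 4 (transvCoeff 10 10 8 a a))
      (binForm 4 (Pi.single i c)) → ∃ (b : ℕ → ℂ) (d : ℂ),
        LinEquivalent (binForm 10 a) (binForm 10 b) ∧
          covK (binForm 10 b) = binForm 4 (Pi.single i d) := by
    rintro i c ⟨p, q, r, s, hdet, hlin⟩
    obtain ⟨b, hb⟩ := exists_eq_binForm (isHomogeneous_linSubst_binForm 10 a p q r s)
    refine ⟨b, (p * s - q * r) ^ 8 * c, ⟨p, q, r, s, hdet, hb⟩, ?_⟩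
    rw [← hb, covK_linSubst, hK, hlin, smul_binForm]
    congr 1
    ext j
    simp [Pi.single_apply]
  obtain ⟨c, hc | hc⟩ := exists_linEquivalent_single hquartic
  all_goals
    obtain ⟨b, d, hab, hb⟩ := transfer _ _ hc
    have hbv := h.of_linEquivalent hab
    refine .of_linEquivalent hab.symm ?_
    by_cases hd : d = 0
    · refine hasRootOfMult_of_covK_eq_zero ?_ hbv
      rw [hb, hd, Pi.single_zero]
      simp [binForm]
  · exact hasRootOfMult_of_covK_eq_single_zero hd hb hbv
  · exact (not_covK_eq_single_one hd hb hbv).elim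

theorem binForm_single_zero (n : ℕ) (c : ℂ) :
    binForm n (Pi.single 0 c) = C c * X 0 ^ n := by
  rw [binForm, Finset.sum_eq_single 0]
  · simp
  · intro i _ hi
    simp [hi]
  · simp

theorem transv_single_zero {n m k : ℕ} (hk : k ≠ 0) (hn : k ≤ n) (hm : k ≤ m) (c d : ℂ) :
    transv n m k (binForm n (Pi.single 0 c)) (binForm m (Pi.single 0 d)) = 0 := by
  rw [transv_binForm hn hm, binForm]
  refine Finset.sum_eq_zero fun l _ => ?_
  suffices h : transvCoeff n m k (Pi.single 0 c) (Pi.single 0 d) l = 0 by simp [h]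
  refine Finset.sum_eq_zero fun i _ => ?_
  rw [mulCoeff, Finset.sum_eq_zero fun j _ => ?_, zero_div, mul_zero]
  by_cases hi : i = 0
  · have : l - j + (k - i) ≠ 0 := by omega
    simp only [Pi.single_eq_of_ne this, mul_zero]
  · have : j + i ≠ 0 := by omega
    simp only [Pi.single_eq_of_ne this, zero_mul, mul_zero]

theorem transv_zero_left (n m k : ℕ) (f : MvPolynomial (Fin 2) ℂ) : transv n m k 0 f = 0 := by
  simpa using transv_smul_left n m k 0 0 f

theorem transv_zero_right (n m k : ℕ) (f : MvPolynomial (Fin 2) ℂ) : transv n m k f 0 = 0 := by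
  simpa using transv_smul_right n m k 0 f 0

theorem invariantsVanish_binForm {a : ℕ → ℂ} (h : ∀ i, 5 ≤ i → i ≤ 10 → a i = 0) :
    InvariantsVanish (binForm 10 a) := by
  have h5 := h 5 (by norm_num) (by norm_num)
  have h6 := h 6 (by norm_num) (by norm_num)
  have h7 := h 7 (by norm_num) (by norm_num)
  have h8 := h 8 (by norm_num) (by norm_num)
  have h9 := h 9 (by norm_num) (by norm_num)
  have h10 := h 10 (by norm_num) (by norm_num)
  obtain ⟨c, hK⟩ : ∃ c, covK (binForm 10 a) = binForm 4 (Pi.single 0 c) := by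
    refine ⟨_, transv_binForm_eq (by norm_num) (by norm_num) rfl
      (c := Pi.single 0 (transvCoeff 10 10 8 a a 0)) fun l hl => ?_⟩
    interval_cases l <;>
      simp [transvCoeff, mulCoeff, Finset.sum_range_succ, Nat.choose, h5, h6, h7, h8, h9, h10]
  obtain ⟨d, hM⟩ : ∃ d, covM (binForm 10 a) = binForm 6 (Pi.single 0 d) := by
    rw [covM, hK]
    refine ⟨_, transv_binForm_eq (by norm_num) (by norm_num) rfl
      (c := Pi.single 0 (transvCoeff 10 4 4 a (Pi.single 0 c) 0)) fun l hl => ?_⟩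
    interval_cases l <;>
      simp [transvCoeff, mulCoeff, Finset.sum_range_succ, Nat.choose, h5, h6, h7, h8, h9, h10]
  obtain ⟨q, hQ, hq⟩ : ∃ q, covQ (binForm 10 a) = binForm 8 q ∧ ∀ i, 3 ≤ i → i ≤ 8 → q i = 0 := by
    refine ⟨_, transv_binForm (by norm_num) (by norm_num) a a, fun l hl hl' => ?_⟩
    interval_cases l <;>
      simp [transvCoeff, mulCoeff, Finset.sum_range_succ, Nat.choose, h5, h6, h7, h8, h9, h10]
  have q3 := hq 3 (by norm_num) (by norm_num)
  have q4 := hq 4 (by norm_num) (by norm_num)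
  have q5 := hq 5 (by norm_num) (by norm_num)
  have q6 := hq 6 (by norm_num) (by norm_num)
  have q7 := hq 7 (by norm_num) (by norm_num)
  have q8 := hq 8 (by norm_num) (by norm_num)
  have hKq : covKq (binForm 10 a) = 0 := by
    rw [covKq, hQ, transv_binForm_eq (by norm_num) (by norm_num) rfl (c := 0) fun l hl => ?_]
    · simp [binForm]
    · interval_cases l <;>
        simp [transvCoeff, mulCoeff, Finset.sum_range_succ, Nat.choose, q3, q4, q5, q6, q7, q8]
  have hQQ : ∃ e, transv 8 8 4 (binForm 8 q) (binForm 8 q) = binForm 8 (Pi.single 0 e) := by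
    refine ⟨_, transv_binForm_eq (by norm_num) (by norm_num) rfl
      (c := Pi.single 0 (transvCoeff 8 8 4 q q 0)) fun l hl => ?_⟩
    interval_cases l <;>
      simp [transvCoeff, mulCoeff, Finset.sum_range_succ, Nat.choose, q3, q4, q5, q6, q7, q8]
  have hj2 : j2 (binForm 10 a) = 0 := by
    rw [j2, transv_binForm_self_eq_zero_iff]
    simp [transvCoeff, mulCoeff, Finset.sum_range_succ, Nat.choose, h5, h6, h7, h8, h9, h10]
  have hB6 : B6 (binForm 10 a) = 0 := by
    obtain ⟨e, he⟩ := hQQ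
    rw [B6, hQ, he, transv_binForm_self_eq_zero_iff]
    simp [transvCoeff, mulCoeff, Finset.sum_range_succ, q8]
  have hA12 : A12 (binForm 10 a) = 0 := by
    rw [A12, hM, hK, binForm_single_zero, binForm_single_zero, mul_pow, mul_pow, ← pow_mul,
      ← pow_mul, ← C_pow, ← C_pow, ← binForm_single_zero, ← binForm_single_zero]
    exact transv_single_zero (by norm_num) le_rfl le_rfl _ _
  have h0 {n m k : ℕ} (hk : k ≠ 0) (hn : k ≤ n) (hm : k ≤ m) (c d : ℂ) :=
    transv_single_zero hk hn hm c d
  refine ⟨hj2, ?_, ?_, ?_, hB6, ?_, ?_, ?_, hA12, ?_, ?_⟩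
  · rw [j4, hK, h0] <;> norm_num
  · rw [j6, hK, h0, transv_zero_left] <;> norm_num
  · rw [A6, hM, h0] <;> norm_num
  · rw [j8, covKm, hM, h0, transv_zero_right] <;> norm_num
  · rw [j9, hK, hM, h0, transv_zero_left] <;> norm_num
  · rw [j10, hM, h0, transv_zero_left] <;> norm_num
  · rw [j14, hKq, transv_zero_left, transv_zero_left]
  · rw [A14, hM, h0, transv_zero_right] <;> norm_num

theorem exists_linSubst_eq_X_zero {p q : ℂ} (h : p ≠ 0 ∨ q ≠ 0) :
    ∃ a b c d : ℂ, a * d - b * c ≠ 0 ∧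
      linSubst a b c d (C p * X 0 + C q * X 1) = X 0 := by
  by_cases hp : p = 0
  · have hq : q ≠ 0 := h.resolve_left (not_not_intro hp)
    refine ⟨0, 1, q⁻¹, 0, by simpa using hq, ?_⟩
    simp only [map_mul, linSubst_C, linSubst_X_one, hp, C_0, zero_mul,
      zero_add, add_zero, ← mul_assoc, ← C_mul, mul_inv_cancel₀ hq, C_1, one_mul]
  · refine ⟨p⁻¹, -q / p, 0, 1, by simpa using hp, ?_⟩
    simp only [map_add, map_mul, linSubst_C, linSubst_X_zero, linSubst_X_one, mul_add,
      ← mul_assoc, ← C_mul, mul_inv_cancel₀ hp, mul_div_cancel₀ _ hp, C_1, one_mul, C_0, zero_mul,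
      zero_add, C_neg]
    ring

theorem HasRootOfMult.exists_linEquivalent_binForm {a : ℕ → ℂ}
    (h : HasRootOfMult 6 (binForm 10 a)) :
    ∃ b, LinEquivalent (binForm 10 a) (binForm 10 b) ∧ ∀ i, 5 ≤ i → i ≤ 10 → b i = 0 := by
  obtain ⟨p, q, hpq, hdvd⟩ := h
  obtain ⟨r, s, t, u, hdet, hX⟩ := exists_linSubst_eq_X_zero hpq
  obtain ⟨b, hb⟩ := exists_eq_binForm (isHomogeneous_linSubst_binForm 10 a r s t u)
  refine ⟨b, ⟨r, s, t, u, hdet, hb⟩, fun i hi hi' => ?_⟩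
  obtain ⟨g, hg⟩ := map_dvd (linSubst r s t u) hdvd
  rw [map_pow, hX, hb, X_pow_eq_monomial] at hg
  have hc := congrArg (coeff (Finsupp.single 0 (10 - i) + Finsupp.single 1 i)) hg
  rw [coeff_monomial_mul', if_neg, coeff_binForm] at hc
  · have hch : (Nat.choose 10 i : ℂ) ≠ 0 := by exact_mod_cast (Nat.choose_pos hi').ne'
    simpa [hch, hi'] using hc
  · intro hle
    have := hle 0
    simp at this
    omega

/-- For a binary decimic `f ∈ V₁₀`, the eleven invariants `j₂, j₄, j₆, A₆, B₆, j₈, j₉,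
j₁₀, A₁₂, j₁₄, A₁₄` all vanish at `f` if and only if `f` has a root of multiplicity at
least 6: the common vanishing locus of these eleven invariants is exactly the nullcone
of `V₁₀`. -/
theorem decimic_nullcone_eleven_invariants (f : MvPolynomial (Fin 2) ℂ)
    (hf : f.IsHomogeneous 10) :
    (j2 f = 0 ∧ j4 f = 0 ∧ j6 f = 0 ∧ A6 f = 0 ∧ B6 f = 0 ∧ j8 f = 0 ∧ j9 f = 0 ∧
      j10 f = 0 ∧ A12 f = 0 ∧ j14 f = 0 ∧ A14 f = 0) ↔ HasRootOfMult 6 f := by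
  obtain ⟨a, rfl⟩ := exists_eq_binForm hf
  refine ⟨hasRootOfMult_of_invariantsVanish, fun h => ?_⟩
  obtain ⟨b, hab, hb⟩ := h.exists_linEquivalent_binForm
  exact (invariantsVanish_binForm hb).of_linEquivalent hab.symm
end

section
/- Let f ∈ V_10 and set k = (f,f)_8 ∈ V_4 and m = (f,k)_4 ∈ V_6. If k is a nonzero scalar multiple of x^4 and x^4 divides m, then x^6 divides f. -/
open MvPolynomial

/-- The binary form of degree `n` with normalized coefficients `a`. -/
noncomputable def binaryForm (n : ℕ) (a : ℕ → ℂ) : MvPolynomial (Fin 2) ℂ :=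
  ∑ i ∈ Finset.range (n + 1), C ((n.choose i : ℂ) * a i) * (X 0 ^ (n - i) * X 1 ^ i)

theorem pderiv_zero_binaryForm (n : ℕ) (a : ℕ → ℂ) :
    pderiv 0 (binaryForm (n + 1) a) = ((n + 1 : ℕ) : ℂ) • binaryForm n a := by
  unfold binaryForm
  rw [Finset.sum_range_succ, map_add, map_sum, Finset.smul_sum]
  have h_last : pderiv (0 : Fin 2) (C (((n + 1).choose (n + 1) : ℂ) * a (n + 1)) *
      (X 0 ^ (n + 1 - (n + 1)) * X 1 ^ (n + 1)) : MvPolynomial (Fin 2) ℂ) = 0 := by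
    simp
  rw [h_last, add_zero]
  refine Finset.sum_congr rfl fun i hi => ?_
  obtain ⟨j, rfl⟩ := Nat.exists_eq_add_of_le (Nat.lt_succ_iff.mp (Finset.mem_range.mp hi))
  have h := Nat.choose_mul_succ_eq (i + j) i
  rw [show i + j + 1 - i = j + 1 by omega] at h
  rw [show i + j + 1 - i = j + 1 by omega, show i + j - i = j by omega]
  have h' : C (((i + j).choose i : ℕ) : ℂ) * C ((i + j + 1 : ℕ) : ℂ) =
      C (((i + j + 1).choose i : ℕ) : ℂ) * (C ((j + 1 : ℕ) : ℂ) : MvPolynomial (Fin 2) ℂ) := by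
    rw [← C_mul, ← C_mul]
    exact_mod_cast congrArg (fun k : ℕ => (C (k : ℂ) : MvPolynomial (Fin 2) ℂ)) h
  simp only [Derivation.leibniz, Derivation.leibniz_pow, pderiv_C, pderiv_X_self,
    pderiv_X_of_ne (show (1 : Fin 2) ≠ 0 by decide), C_mul, smul_eq_C_mul, smul_eq_mul,
    nsmul_eq_mul, smul_zero, mul_zero, zero_add, add_zero, Nat.add_sub_cancel, mul_one]
  rw [show ((j + 1 : ℕ) : MvPolynomial (Fin 2) ℂ) = C ((j + 1 : ℕ) : ℂ) by simp]
  linear_combination (-C (a i) * X 0 ^ j * X 1 ^ i) * h'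

theorem pderiv_one_binaryForm (n : ℕ) (a : ℕ → ℂ) :
    pderiv 1 (binaryForm (n + 1) a) =
      ((n + 1 : ℕ) : ℂ) • binaryForm n (fun i => a (i + 1)) := by
  unfold binaryForm
  rw [Finset.sum_range_succ', map_add, map_sum, Finset.smul_sum]
  have h_first : pderiv (1 : Fin 2) (C (((n + 1).choose 0 : ℂ) * a 0) *
      (X 0 ^ (n + 1 - 0) * X 1 ^ 0) : MvPolynomial (Fin 2) ℂ) = 0 := by
    simp
  rw [h_first, add_zero]
  refine Finset.sum_congr rfl fun i hi => ?_
  have h' : C ((n + 1 : ℕ) : ℂ) * C ((n.choose i : ℕ) : ℂ) =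
      C (((n + 1).choose (i + 1) : ℕ) : ℂ) *
        (C ((i + 1 : ℕ) : ℂ) : MvPolynomial (Fin 2) ℂ) := by
    rw [← C_mul, ← C_mul]
    exact_mod_cast congrArg (fun k : ℕ => (C (k : ℂ) : MvPolynomial (Fin 2) ℂ))
      (Nat.add_one_mul_choose_eq n i)
  simp only [Derivation.leibniz, Derivation.leibniz_pow, pderiv_C, pderiv_X_self,
    pderiv_X_of_ne (show (0 : Fin 2) ≠ 1 by decide), C_mul, smul_eq_C_mul, smul_eq_mul,
    nsmul_eq_mul, smul_zero, mul_zero, add_zero, Nat.add_sub_cancel, mul_one,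
    Nat.add_sub_add_right]
  rw [show ((i + 1 : ℕ) : MvPolynomial (Fin 2) ℂ) = C ((i + 1 : ℕ) : ℂ) by simp]
  linear_combination (-C (a (i + 1)) * X 0 ^ (n - i) * X 1 ^ i) * h'

theorem iterate_pderiv_zero_binaryForm (n p : ℕ) (c : ℂ) (a : ℕ → ℂ) :
    (fun q => pderiv (0 : Fin 2) q)^[p] (c • binaryForm (n + p) a) =
      (c * ((n + p).factorial / n.factorial)) • binaryForm n a := by
  induction p generalizing c with
  | zero => simp [Nat.factorial_ne_zero]
  | succ p ih =>
    rw [Function.iterate_succ_apply, Derivation.map_smul, ← add_assoc, pderiv_zero_binaryForm,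
      smul_smul, ih, Nat.factorial_succ (n + p)]
    congr 1
    push_cast
    ring

theorem iterate_pderiv_one_binaryForm (n p : ℕ) (c : ℂ) (a : ℕ → ℂ) :
    (fun q => pderiv (1 : Fin 2) q)^[p] (c • binaryForm (n + p) a) =
      (c * ((n + p).factorial / n.factorial)) • binaryForm n (fun i => a (i + p)) := by
  induction p generalizing c a with
  | zero => simp [Nat.factorial_ne_zero]
  | succ p ih =>
    rw [Function.iterate_succ_apply, Derivation.map_smul, ← add_assoc, pderiv_one_binaryForm,
      smul_smul, ih, Nat.factorial_succ (n + p)]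
    congr 1
    push_cast
    ring

theorem iterate_pderiv_binaryForm (n p q : ℕ) (a : ℕ → ℂ) :
    (fun r => pderiv (0 : Fin 2) r)^[p]
        ((fun r => pderiv (1 : Fin 2) r)^[q] (binaryForm (n + (p + q)) a)) =
      (((n + (p + q)).factorial : ℂ) / n.factorial) • binaryForm n (fun i => a (i + q)) := by
  have h := iterate_pderiv_one_binaryForm (n + p) q 1 a
  rw [one_smul, one_mul, add_assoc] at h
  rw [h, iterate_pderiv_zero_binaryForm]
  congr 1
  have := Nat.factorial_ne_zero (n + p)
  field_simp

theorem transv_binaryForm (n m k : ℕ) (a b : ℕ → ℂ) :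
    transv (n + k) (m + k) k (binaryForm (n + k) a) (binaryForm (m + k) b) =
      ∑ i ∈ Finset.range (k + 1), ((-1 : ℂ) ^ i * (k.choose i : ℂ)) •
        (binaryForm n (fun j => a (j + i)) * binaryForm m (fun j => b (j + (k - i)))) := by
  unfold transv
  rw [Finset.smul_sum]
  refine Finset.sum_congr rfl fun i hi => ?_
  have hi' : i ≤ k := Nat.lt_succ_iff.mp (Finset.mem_range.mp hi)
  have h₁ := iterate_pderiv_binaryForm n (k - i) i a
  have h₂ := iterate_pderiv_binaryForm m i (k - i) b
  rw [Nat.sub_add_cancel hi'] at h₁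
  rw [Nat.add_sub_cancel' hi'] at h₂
  rw [h₁, h₂, smul_mul_smul_comm, smul_smul, smul_smul]
  congr 1
  have := Nat.factorial_ne_zero n
  have := Nat.factorial_ne_zero m
  have := Nat.factorial_ne_zero (n + k)
  have := Nat.factorial_ne_zero (m + k)
  simp only [Nat.add_sub_cancel]
  push_cast
  field_simp

theorem MvPolynomial.IsHomogeneous.exists_eq_binaryForm {n : ℕ} {f : MvPolynomial (Fin 2) ℂ}
    (hf : f.IsHomogeneous n) : ∃ a, f = binaryForm n a := by
  refine ⟨fun i => coeff (Finsupp.single 0 (n - i) + Finsupp.single 1 i) f / n.choose i, ?_⟩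
  have h_mono (i : ℕ) (c : ℂ) : C c * (X 0 ^ (n - i) * X 1 ^ i) =
      monomial (Finsupp.single (0 : Fin 2) (n - i) + Finsupp.single 1 i) c := by
    simp [X_pow_eq_monomial, monomial_mul, C_mul_monomial]
  ext d
  simp only [binaryForm, h_mono, coeff_sum, coeff_monomial]
  by_cases hd : d 0 + d 1 = n
  · rw [Finset.sum_eq_single (d 1)]
    · have h_eq : Finsupp.single (0 : Fin 2) (n - d 1) + Finsupp.single 1 (d 1) = d := by
        ext j
        fin_cases j
        · simp
          omega
        · simp
      have h_ne : (n.choose (d 1) : ℂ) ≠ 0 := by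
        exact_mod_cast (Nat.choose_pos (by omega : d 1 ≤ n)).ne'
      rw [if_pos h_eq, h_eq, mul_div_cancel₀ _ h_ne]
    · intro i _ hi
      refine if_neg fun h => hi ?_
      simpa using DFunLike.congr_fun h 1
    · intro h
      exact absurd (Finset.mem_range.mpr (by omega)) h
  · rw [hf.coeff_eq_zero, Finset.sum_eq_zero]
    · intro i hi
      refine if_neg fun h => hd ?_
      have := Finset.mem_range.mp hi
      rw [← h]
      simp
      omega
    · rwa [Finsupp.degree_eq_sum, Fin.sum_univ_two]

theorem eval_binaryForm (n : ℕ) (a : ℕ → ℂ) (t : ℂ) :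
    eval ![t, 1] (binaryForm n a) =
      ∑ i ∈ Finset.range (n + 1), (n.choose i : ℂ) * a i * t ^ (n - i) := by
  simp [binaryForm]

theorem coeff_eq_zero_of_X_zero_pow_dvd_binaryForm {n r : ℕ} {a : ℕ → ℂ}
    (h : X 0 ^ r ∣ binaryForm n a) {i : ℕ} (hi : i ≤ n) (hr : n < i + r) : a i = 0 := by
  have h' := map_dvd (aeval ![(Polynomial.X : Polynomial ℂ), 1]) h
  have h_aeval : aeval ![(Polynomial.X : Polynomial ℂ), 1] (binaryForm n a) =
      ∑ j ∈ Finset.range (n + 1),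
        Polynomial.C ((n.choose j : ℂ) * a j) * Polynomial.X ^ (n - j) := by
    simp [binaryForm]
  simp only [map_pow, aeval_X, Matrix.cons_val_zero, h_aeval, Polynomial.X_pow_dvd_iff] at h'
  have h_coeff := h' (n - i) (by omega)
  simp only [Polynomial.finsetSum_coeff, Polynomial.coeff_C_mul_X_pow] at h_coeff
  rw [Finset.sum_eq_single i] at h_coeff
  · simpa [(Nat.choose_pos hi).ne'] using h_coeff
  · intro j hj hji
    have := Finset.mem_range.mp hj
    exact if_neg (by omega)
  · intro h
    exact absurd (Finset.mem_range.mpr (by omega)) h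

theorem X_zero_pow_dvd_binaryForm {n r : ℕ} {a : ℕ → ℂ}
    (h : ∀ i ≤ n, n < i + r → a i = 0) : X 0 ^ r ∣ binaryForm n a := by
  refine Finset.dvd_sum fun i hi => ?_
  by_cases hr : n < i + r
  · simp [h i (Nat.lt_succ_iff.mp (Finset.mem_range.mp hi)) hr]
  · exact ((pow_dvd_pow _ (by omega)).mul_right _).mul_left _

/-- Let `f ∈ V₁₀`, `k = (f,f)₈ ∈ V₄`, `m = (f,k)₄ ∈ V₆`. If `k` is a nonzero scalar
multiple of `x⁴` and `x⁴` divides `m`, then `x⁶` divides `f`. -/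
theorem case_k_eq_x4 (f : MvPolynomial (Fin 2) ℂ) (hf : f.IsHomogeneous 10)
    (c : ℂ) (hc : c ≠ 0) (hk : covK f = C c * X 0 ^ 4)
    (hm : X 0 ^ 4 ∣ covM f) :
    X 0 ^ 6 ∣ f := by
  obtain ⟨a, rfl⟩ := hf.exists_eq_binaryForm
  have h_k : C c * X 0 ^ 4 = binaryForm 4 (fun i => if i = 0 then c else 0) := by
    simp [binaryForm, Finset.sum_range_succ]
  have h_m : covM (binaryForm 10 a) = C c * binaryForm 6 (fun i => a (i + 4)) := by
    rw [covM, hk, h_k, transv_binaryForm 6 0 4]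
    simp [Finset.sum_range_succ, binaryForm]
    rw [Even.neg_one_pow (by decide), one_smul]
    ring
  rw [h_m] at hm
  have h_dvd : X 0 ^ 4 ∣ binaryForm 6 (fun i => a (i + 4)) :=
    ((isUnit_iff_ne_zero.mpr hc).map C).dvd_mul_left.mp hm
  have h7 : a 7 = 0 :=
    coeff_eq_zero_of_X_zero_pow_dvd_binaryForm h_dvd (i := 3) (by norm_num) (by norm_num)
  have h8 : a 8 = 0 :=
    coeff_eq_zero_of_X_zero_pow_dvd_binaryForm h_dvd (i := 4) (by norm_num) (by norm_num)
  have h9 : a 9 = 0 :=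
    coeff_eq_zero_of_X_zero_pow_dvd_binaryForm h_dvd (i := 5) (by norm_num) (by norm_num)
  have h10 : a 10 = 0 :=
    coeff_eq_zero_of_X_zero_pow_dvd_binaryForm h_dvd (i := 6) (by norm_num) (by norm_num)
  rw [covK, transv_binaryForm 2 2 8] at hk
  have h_eval (t : ℂ) := congrArg (eval ![t, 1]) hk
  simp only [map_sum, smul_eval, map_mul, eval_binaryForm, eval_C, map_pow, eval_X,
    Matrix.cons_val_zero] at h_eval
  norm_num [Finset.sum_range_succ, Nat.choose, h7, h8, h9, h10] at h_eval
  have h6 : a 6 = 0 := by simpa using h_eval 0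
  simp only [h6] at h_eval
  have h5 : a 5 ^ 2 = 0 := by
    linear_combination (16 * (h_eval 1 + h_eval (-1)) - (h_eval 2 + h_eval (-2))) / (24 * 168)
  have h5' : a 5 = 0 := by simpa using h5
  refine X_zero_pow_dvd_binaryForm fun i hi hr => ?_
  interval_cases i <;> first | assumption | omega
end
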